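/- Let n ≥ 1, m ∈ ℝ, j ≥ 1 an integer, and let a(x,y,ξ) be measurable and bounded in (x,y), C^∞ in ξ, with sup_{x,y ∈ ℝ^n} |∂_ξ^α a(x,y,ξ)| ≤ C_α (1+|ξ|^2)^{(m−|α|)/2} for all multi-indices α. Let φ ∈ Φ^2, and let Φ(x,y,ξ) denote either φ(x,ξ) − y·ξ or x·ξ − φ(y,ξ). Let ξ_j^ν be a unit vector and let χ_j^ν ∈ C^∞(ℝ^n ∖ {0}) be supported in the cone Γ_j^ν = {ξ ≠ 0 : |ξ/|ξ| − ξ_j^ν| ≤ 2·2^{−j/2}} and satisfy, for constants independent of j and ν, |∂_ξ^α χ_j^ν(ξ)| ≤ C_α 2^{j|α|/2} |ξ|^{−|α|} for all multi-indices α and, writing ξ = (ξ_1, ξ′) in orthonormal coordinates with the ξ_1-axis along ξ_j^ν, |∂_{ξ_1}^N χ_j^ν(ξ)| ≤ C_N |ξ|^{−N} for all integers N ≥ 1. Define K_j^ν(x,y) = (2π)^{−n} ∫ e^{iΦ(x,y,ξ)} ψ_j(ξ) χ_j^ν(ξ) a(x,y,ξ) dξ. Then for every N ≥ 0 there exists a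 constant C, depending only on N, n, m and the constants above (in particular independent of j, ν, x, y), such that |K_j^ν(x,y)| ≤ C 2^{j(m+(n+1)/2)} (1 + |2^j ∂_{ξ_1} Φ(x,y,ξ_j^ν)|^2)^{−N} (1 + |2^{j/2} ∇_{ξ′} Φ(x,y,ξ_j^ν)|^2)^{−N}, where ∂_{ξ_1} denotes the ξ-derivative in the direction ξ_j^ν and ∇_{ξ′} the ξ-gradient in the directions orthogonal to ξ_j^ν. -/

import Mathlib

noncomputable section

open MeasureTheory Complex
open scoped ENNReal NNReal InnerProductSpace

/-- Euclidean space `ℝ^n`. -/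
abbrev Rn (n : ℕ) := EuclideanSpace ℝ (Fin n)

/-- The Fourier transform `f̂(ξ) = ∫ e^{-i x·ξ} f(x) dx`. -/
def ftransform (n : ℕ) (f : Rn n → ℂ) (ξ : Rn n) : ℂ :=
  ∫ x : Rn n, Complex.exp (-(Complex.I * ((⟪x, ξ⟫_ℝ : ℝ) : ℂ))) * f x

/-- The Fourier integral operator `T_a^φ f(x) = (2π)^{-n} ∫ a(x,ξ) e^{iφ(x,ξ)} f̂(ξ) dξ`. -/
def fio (n : ℕ) (a : Rn n → Rn n → ℂ) (φ : Rn n → Rn n → ℝ) (f : Rn n → ℂ) (x : Rn n) : ℂ :=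
  ((((2 * Real.pi) ^ n)⁻¹ : ℝ) : ℂ) *
    ∫ ξ : Rn n, a x ξ * Complex.exp (Complex.I * ((φ x ξ : ℝ) : ℂ)) * ftransform n f ξ

/-- The Littlewood–Paley pieces `ψ_j` built from `ψ_0`. -/
def lpPiece (n : ℕ) (ψ0 : Rn n → ℝ) (j : ℕ) (ξ : Rn n) : ℝ :=
  if j = 0 then ψ0 ξ
  else ψ0 ((2 : ℝ) ^ (-(j : ℤ)) • ξ) - ψ0 ((2 : ℝ) ^ (-(j : ℤ) + 1) • ξ)

/-- Hypotheses on the base function `ψ_0` of a Littlewood–Paley partition of unity. -/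
def IsLPBase (n : ℕ) (ψ0 : Rn n → ℝ) : Prop :=
  ContDiff ℝ (⊤ : ℕ∞) ψ0 ∧ (∀ ξ : Rn n, ‖ξ‖ ≤ 1 → ψ0 ξ = 1) ∧ (∀ ξ : Rn n, 2 < ‖ξ‖ → ψ0 ξ = 0)

/-- Inverse Fourier transform of a real-valued function. -/
def invFT (n : ℕ) (h : Rn n → ℝ) (x : Rn n) : ℂ :=
  ((((2 * Real.pi) ^ n)⁻¹ : ℝ) : ℂ) *
    ∫ ξ : Rn n, Complex.exp (Complex.I * ((⟪x, ξ⟫_ℝ : ℝ) : ℂ)) * ((h ξ : ℝ) : ℂ)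

/-- The operator `h(D) g`: convolution of `g` with the inverse Fourier transform of `h`. -/
def smoothOp (n : ℕ) (h : Rn n → ℝ) (g : Rn n → ℂ) (x : Rn n) : ℂ :=
  ∫ y : Rn n, invFT n h (x - y) * g y

/-- `ℓ^q`-norm of a sequence in `ℝ≥0∞`, for `0 < q ≤ ∞`. -/
def lqSum (q : ℝ≥0∞) (u : ℕ → ℝ≥0∞) : ℝ≥0∞ :=
  if q = ∞ then ⨆ j, u j else (∑' j, u j ^ q.toReal) ^ (1 / q.toReal)

/-- Besov–Lipschitz quasi-norm `‖g‖_{B^s_{p,q}}`. -/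
def besovNorm (n : ℕ) (ψ0 : Rn n → ℝ) (s : ℝ) (p q : ℝ≥0∞) (g : Rn n → ℂ) : ℝ≥0∞ :=
  lqSum q fun j =>
    ENNReal.ofReal ((2 : ℝ) ^ ((j : ℝ) * s)) * eLpNorm (smoothOp n (lpPiece n ψ0 j) g) p volume

/-- Triebel–Lizorkin quasi-norm `‖g‖_{F^s_{p,q}}`. -/
def tlNorm (n : ℕ) (ψ0 : Rn n → ℝ) (s : ℝ) (p q : ℝ≥0∞) (g : Rn n → ℂ) : ℝ≥0∞ :=
  if p = ∞ then
    essSup (fun x : Rn n => lqSum q fun j =>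
      ENNReal.ofReal ((2 : ℝ) ^ ((j : ℝ) * s)) *
        (‖smoothOp n (lpPiece n ψ0 j) g x‖₊ : ℝ≥0∞)) volume
  else
    (∫⁻ x : Rn n, (lqSum q fun j =>
      ENNReal.ofReal ((2 : ℝ) ^ ((j : ℝ) * s)) *
        (‖smoothOp n (lpPiece n ψ0 j) g x‖₊ : ℝ≥0∞)) ^ p.toReal ∂volume) ^ (1 / p.toReal)

/-- Critical order `m_c(p) = -(n-1)|1/p - 1/2|`. -/
def criticalOrder (n : ℕ) (p : ℝ≥0∞) : ℝ := -((n : ℝ) - 1) * |p⁻¹.toReal - 1 / 2|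

/-- The symbol class `S^m(ℝ^n)`. -/
def SymbolClass (n : ℕ) (m : ℝ) (a : Rn n → Rn n → ℂ) : Prop :=
  ContDiff ℝ (⊤ : ℕ∞) (fun p : Rn n × Rn n => a p.1 p.2) ∧
  ∀ k l : ℕ, ∃ C : ℝ, ∀ x ξ : Rn n,
    ‖iteratedFDeriv ℝ k (fun ξ' => iteratedFDeriv ℝ l (fun x' => a x' ξ') x) ξ‖ ≤
      C * (1 + ‖ξ‖ ^ 2) ^ ((m - (k : ℝ)) / 2)

/-- Smoothness away from `ξ = 0` and positive homogeneity of degree 1 in `ξ` of a phase. -/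
def PhaseSmoothHomog (n : ℕ) (φ : Rn n → Rn n → ℝ) : Prop :=
  ContDiffOn ℝ (⊤ : ℕ∞) (fun p : Rn n × Rn n => φ p.1 p.2) {p : Rn n × Rn n | p.2 ≠ 0} ∧
  ∀ (x ξ : Rn n) (t : ℝ), 0 < t → φ x (t • ξ) = t * φ x ξ

/-- The phase class `Φ^k`. -/
def PhaseClass (n : ℕ) (k : ℕ) (φ : Rn n → Rn n → ℝ) : Prop :=
  PhaseSmoothHomog n φ ∧
  ∀ a b : ℕ, k ≤ a + b → ∃ C : ℝ, ∀ x ξ : Rn n, ξ ≠ 0 →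
    ‖ξ‖ ^ ((a : ℝ) - 1) *
      ‖iteratedFDerivWithin ℝ a
        (fun ξ' => iteratedFDeriv ℝ b (fun x' => φ x' ξ') x) {ξ' : Rn n | ξ' ≠ 0} ξ‖ ≤ C

/-- Determinant of the mixed Hessian `(∂²φ/∂x_i∂ξ_k)`. -/
def mixedHessianDet (n : ℕ) (φ : Rn n → Rn n → ℝ) (x ξ : Rn n) : ℝ :=
  Matrix.det (Matrix.of fun i k : Fin n =>
    fderiv ℝ (fun x' => fderiv ℝ (fun ξ' => φ x' ξ') ξ (EuclideanSpace.single k 1)) x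
      (EuclideanSpace.single i 1))

/-- The strong non-degeneracy (SND) condition. -/
def SNDCondition (n : ℕ) (φ : Rn n → Rn n → ℝ) : Prop :=
  ∃ δ : ℝ, 0 < δ ∧ ∀ x ξ : Rn n, ξ ≠ 0 → δ ≤ |mixedHessianDet n φ x ξ|

/-- Non-degeneracy of the phase on a compact set `K`. -/
def NonDegenerateOn (n : ℕ) (φ : Rn n → Rn n → ℝ) (K : Set (Rn n)) : Prop :=
  ∀ x ∈ K, ∀ ξ : Rn n, ξ ≠ 0 → mixedHessianDet n φ x ξ ≠ 0

section KernelEstimate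

open scoped ContDiff

section Directional

variable {E F : Type*} [NormedAddCommGroup E] [NormedSpace ℝ E]
  [NormedAddCommGroup F] [NormedSpace ℝ F] {U : Set E} {f : E → F} {x : E}

/-- The directional derivatives of `f` are the iterated derivatives of its restriction to a line. -/
theorem iteratedFDerivWithin_line (hU : IsOpen U) (hf : ContDiffOn ℝ ∞ f U) (hx : x ∈ U)
    (v : E) (k : ℕ) :
    iteratedFDerivWithin ℝ k (fun t : ℝ => f (x + t • v)) {t : ℝ | x + t • v ∈ U} 0 (fun _ => 1) =
      iteratedFDerivWithin ℝ k f U x (fun _ => v) := by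
  have hV : IsOpen ((fun z => x + z) ⁻¹' U) := hU.preimage (by fun_prop)
  have hf' : ContDiffOn ℝ ∞ (fun z => f (x + z)) ((fun z => x + z) ⁻¹' U) :=
    hf.comp (by fun_prop) (Set.mapsTo_preimage _ _)
  have hW : IsOpen (ContinuousLinearMap.toSpanSingleton ℝ v ⁻¹' ((fun z => x + z) ⁻¹' U)) :=
    hV.preimage (by fun_prop)
  have h0 : ContinuousLinearMap.toSpanSingleton ℝ v 0 ∈ (fun z => x + z) ⁻¹' U := by simpa using hx
  have key := ContinuousLinearMap.iteratedFDerivWithin_comp_right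
    (ContinuousLinearMap.toSpanSingleton ℝ v) hf' hV.uniqueDiffOn hW.uniqueDiffOn h0
    (i := k) (by exact_mod_cast le_top)
  have h2 : iteratedFDerivWithin ℝ k (fun z => f (x + z)) ((fun z => x + z) ⁻¹' U) 0 =
      iteratedFDerivWithin ℝ k f U x := by
    rw [iteratedFDerivWithin_of_isOpen k hV (by simpa using hx), iteratedFDeriv_comp_add_left,
      iteratedFDerivWithin_of_isOpen k hU hx, add_zero]
  rw [map_zero, h2] at key
  change iteratedFDerivWithin ℝ k ((fun z => f (x + z)) ∘ ContinuousLinearMap.toSpanSingleton ℝ v)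
    (ContinuousLinearMap.toSpanSingleton ℝ v ⁻¹' ((fun z => x + z) ⁻¹' U)) 0 _ = _
  rw [key]
  simp

theorem norm_iteratedFDerivWithin_line (hU : IsOpen U) (hf : ContDiffOn ℝ ∞ f U) (hx : x ∈ U)
    (v : E) (k : ℕ) :
    ‖iteratedFDerivWithin ℝ k (fun t : ℝ => f (x + t • v)) {t : ℝ | x + t • v ∈ U} 0‖ =
      ‖iteratedFDerivWithin ℝ k f U x (fun _ => v)‖ := by
  rw [norm_iteratedFDerivWithin_eq_norm_iteratedDerivWithin, ← iteratedFDerivWithin_line hU hf hx]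
  rfl

theorem isOpen_line_preimage (hU : IsOpen U) (x v : E) : IsOpen {t : ℝ | x + t • v ∈ U} :=
  hU.preimage (by fun_prop)

theorem ContDiffOn.comp_line (hf : ContDiffOn ℝ ∞ f U) (x v : E) :
    ContDiffOn ℝ ∞ (fun t : ℝ => f (x + t • v)) {t : ℝ | x + t • v ∈ U} :=
  hf.comp (by fun_prop) fun _ ht => ht

/-- The first `k` derivatives of `f` at `x` in direction `v` satisfy symbol bounds of size `A`
and scale `r`. -/
def DirBound (U : Set E) (f : E → F) (x v : E) (r : ℝ) (k : ℕ) (A : ℝ) : Prop :=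
  ∀ i ≤ k, ‖iteratedFDerivWithin ℝ i f U x (fun _ => v)‖ ≤ A * r ^ i

theorem DirBound.mul {f g : E → ℂ} (hU : IsOpen U) (hx : x ∈ U) (hf : ContDiffOn ℝ ∞ f U)
    (hg : ContDiffOn ℝ ∞ g U) {v : E} {r A B : ℝ} {k : ℕ} (hr : 0 ≤ r) (hA : 0 ≤ A) (hB : 0 ≤ B)
    (hfA : DirBound U f x v r k A) (hgB : DirBound U g x v r k B) :
    DirBound U (fun y => f y * g y) x v r k (2 ^ k * A * B) := by
  intro i hi
  rw [← norm_iteratedFDerivWithin_line hU (hf.mul hg) hx]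
  refine (norm_iteratedFDerivWithin_mul_le (hf.comp_line x v) (hg.comp_line x v)
    (isOpen_line_preimage hU x v).uniqueDiffOn (by simpa using hx)
    (n := i) (by exact_mod_cast le_top)).trans ?_
  calc _ ≤ ∑ l ∈ Finset.range (i + 1), (i.choose l : ℝ) * (A * B * r ^ i) := by
        refine Finset.sum_le_sum fun l hl => ?_
        have hl' : l ≤ i := Nat.lt_succ_iff.1 (Finset.mem_range.1 hl)
        rw [norm_iteratedFDerivWithin_line hU hf hx, norm_iteratedFDerivWithin_line hU hg hx,
          mul_assoc]
        refine mul_le_mul_of_nonneg_left ?_ (by positivity)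
        calc _ ≤ (A * r ^ l) * (B * r ^ (i - l)) :=
              mul_le_mul (hfA l (hl'.trans hi)) (hgB _ ((Nat.sub_le _ _).trans hi))
                (norm_nonneg _) (by positivity)
          _ = A * B * (r ^ l * r ^ (i - l)) := by ring
          _ = A * B * r ^ i := by rw [← pow_add, Nat.add_sub_cancel' hl']
    _ = 2 ^ i * A * B * r ^ i := by
        rw [← Finset.sum_mul]
        have := Nat.sum_range_choose i
        have h' : ∑ l ∈ Finset.range (i + 1), (i.choose l : ℝ) = 2 ^ i := by exact_mod_cast this
        rw [h']; ring
    _ ≤ 2 ^ k * A * B * r ^ i := by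
        gcongr
        norm_num

theorem norm_iteratedFDeriv_exp_I_mul_le (i : ℕ) (t : ℝ) :
    ‖iteratedFDeriv ℝ i (fun s : ℝ => Complex.exp (Complex.I * (s : ℂ))) t‖ ≤ 1 := by
  have h : ∀ i : ℕ, iteratedDeriv i (fun s : ℝ => Complex.exp (Complex.I * (s : ℂ))) =
      fun s : ℝ => Complex.I ^ i * Complex.exp (Complex.I * (s : ℂ)) := by
    intro i
    induction i with
    | zero => simp
    | succ i ih =>
      rw [iteratedDeriv_succ, ih]
      ext s
      have h1 : HasDerivAt (fun s : ℝ => Complex.I * (s : ℂ)) (Complex.I * 1) s :=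
        (Complex.ofRealCLM.hasDerivAt (x := s)).const_mul _
      rw [(h1.cexp.const_mul (Complex.I ^ i)).deriv]
      ring
  rw [norm_iteratedFDeriv_eq_norm_iteratedDeriv, h]
  simp [Complex.norm_exp]

theorem contDiff_exp_I_mul : ContDiff ℝ ∞ (fun s : ℝ => Complex.exp (Complex.I * (s : ℂ))) :=
  (contDiff_const.mul Complex.ofRealCLM.contDiff).cexp

theorem DirBound.cexp {h : E → ℝ} (hU : IsOpen U) (hx : x ∈ U) (hh : ContDiffOn ℝ ∞ h U)
    {v : E} {r c : ℝ} {k : ℕ} (hr : 0 ≤ r) (hc : 1 ≤ c)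
    (hb : ∀ i, 1 ≤ i → i ≤ k → ‖iteratedFDerivWithin ℝ i h U x (fun _ => v)‖ ≤ c * r ^ i) :
    DirBound U (fun y => Complex.exp (Complex.I * (h y : ℂ))) x v r k (k.factorial * c ^ k) := by
  intro i hi
  have hcd : ContDiffOn ℝ ∞ (fun y => Complex.exp (Complex.I * (h y : ℂ))) U :=
    contDiff_exp_I_mul.comp_contDiffOn hh
  rw [← norm_iteratedFDerivWithin_line hU hcd hx]
  have key := norm_iteratedFDerivWithin_comp_le (𝕜 := ℝ) (n := i) (N := ∞) (x := 0) (C := 1)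
    (D := c * r) (contDiff_exp_I_mul.contDiffOn (s := Set.univ)) (hh.comp_line x v)
    (by exact_mod_cast le_top) uniqueDiffOn_univ
    (isOpen_line_preimage hU x v).uniqueDiffOn (Set.mapsTo_univ _ _) (by simpa using hx)
    (fun l _ => by
      rw [iteratedFDerivWithin_univ]; exact norm_iteratedFDeriv_exp_I_mul_le _ _)
    (fun l hl1 hl => by
      rw [norm_iteratedFDerivWithin_line hU hh hx, mul_pow]
      refine (hb l hl1 (hl.trans hi)).trans ?_
      gcongr
      exact le_self_pow₀ hc (by omega))
  refine key.trans ?_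
  rw [mul_one, mul_pow, ← mul_assoc]
  gcongr

theorem DirBound.ofReal {f : E → ℝ} (hU : IsOpen U) (hx : x ∈ U) (hf : ContDiffOn ℝ ∞ f U)
    {v : E} {r A : ℝ} {k : ℕ} (h : DirBound U f x v r k A) :
    DirBound U (fun y => (f y : ℂ)) x v r k A := by
  intro i hi
  have := Complex.ofRealCLM.iteratedFDerivWithin_comp_left (hf x hx) hU.uniqueDiffOn hx
    (i := i) (by exact_mod_cast le_top)
  change ‖iteratedFDerivWithin ℝ i (Complex.ofRealCLM ∘ f) U x _‖ ≤ _
  rw [this]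
  simpa using h i hi

end Directional

section HomogeneousPhase

universe u

theorem iteratedFDeriv_clm_comp {E F G : Type*} [NormedAddCommGroup E] [NormedSpace ℝ E]
    [NormedAddCommGroup F] [NormedSpace ℝ F] [NormedAddCommGroup G] [NormedSpace ℝ G]
    (L : F →L[ℝ] G) {f : E → F} {x : E} (hf : ContDiffAt ℝ ∞ f x) (k : ℕ) (m : Fin k → E) :
    iteratedFDeriv ℝ k (fun y => L (f y)) x m = L (iteratedFDeriv ℝ k f x m) := by
  have := L.iteratedFDeriv_comp_left hf (i := k) (by exact_mod_cast le_top)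
  change iteratedFDeriv ℝ k (L ∘ f) x m = _
  rw [this]; rfl

/-- In a derivative of a smooth function, one direction may be moved past repetitions of another. -/
theorem iteratedFDeriv_succ_cons_const {E : Type u} [NormedAddCommGroup E] [NormedSpace ℝ E]
    {U : Set E} (hU : IsOpen U) (e w : E) (k : ℕ) :
    ∀ {F : Type u} [NormedAddCommGroup F] [NormedSpace ℝ F] {f : E → F}, ContDiffOn ℝ ∞ f U →
      ∀ x ∈ U, iteratedFDeriv ℝ (k + 1) f x (Fin.cons w (fun _ => e)) =
        iteratedFDeriv ℝ k (fderiv ℝ f) x (fun _ => e) w := by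
  induction k with
  | zero =>
    intro F _ _ f hf x hx
    rw [iteratedFDeriv_succ_apply_right]
    simp
  | succ k ih =>
    intro F _ _ f hf x hx
    have hf1 : ContDiffOn ℝ ∞ (fderiv ℝ f) U := hf.fderiv_of_isOpen hU (by simp)
    have hf2 : ContDiffOn ℝ ∞ (fderiv ℝ (fderiv ℝ f)) U := hf1.fderiv_of_isOpen hU (by simp)
    have hat : ContDiffAt ℝ ∞ (fderiv ℝ (fderiv ℝ f)) x := hf2.contDiffAt (hU.mem_nhds hx)
    rw [iteratedFDeriv_succ_apply_right]
    have hinit : Fin.init (Fin.cons w (fun _ : Fin (k + 1) => e) : Fin (k + 2) → E) =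
        (Fin.cons w (fun _ : Fin k => e) : Fin (k + 1) → E) := by
      ext i
      refine Fin.cases ?_ (fun i => ?_) i
      · rfl
      · simp [Fin.init]
    have hlast : (Fin.cons w (fun _ : Fin (k + 1) => e) : Fin (k + 2) → E) (Fin.last (k + 1)) = e := by
      rw [← Fin.succ_last, Fin.cons_succ]
    rw [hinit, hlast, ih hf1 x hx, iteratedFDeriv_succ_apply_right]
    change iteratedFDeriv ℝ k (fderiv ℝ (fderiv ℝ f)) x (fun _ => e) w e =
      iteratedFDeriv ℝ k (fderiv ℝ (fderiv ℝ f)) x (fun _ => e) e w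
    have h1 := iteratedFDeriv_clm_comp ((ContinuousLinearMap.apply ℝ F e).comp
      (ContinuousLinearMap.apply ℝ (E →L[ℝ] F) w)) hat k (fun _ => e)
    have h2 := iteratedFDeriv_clm_comp ((ContinuousLinearMap.apply ℝ F w).comp
      (ContinuousLinearMap.apply ℝ (E →L[ℝ] F) e)) hat k (fun _ => e)
    simp only [ContinuousLinearMap.comp_apply, ContinuousLinearMap.apply_apply] at h1 h2
    rw [← h1, ← h2]
    congr 1
    have hev : (fun y => fderiv ℝ (fderiv ℝ f) y w e) =ᶠ[nhds x]
        (fun y => fderiv ℝ (fderiv ℝ f) y e w) := by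
      filter_upwards [hU.mem_nhds hx] with y hy
      have hs : IsSymmSndFDerivAt ℝ f y :=
        (hf.contDiffAt (hU.mem_nhds hy)).isSymmSndFDerivAt (by simpa using WithTop.coe_le_coe.2 (le_top (a := (2 : ℕ∞))))
      exact hs w e
    exact Filter.EventuallyEq.eq_of_nhds (hev.iteratedFDeriv ℝ k)

/-- The derivative of a function which is positively homogeneous of degree one is positively
homogeneous of degree zero. -/
theorem fderiv_smul_of_homogeneous {E : Type*} [NormedAddCommGroup E] [NormedSpace ℝ E]
    {P : E → ℝ} (hP : ∀ (ξ : E) (t : ℝ), 0 < t → P (t • ξ) = t * P ξ) (ξ : E) {t : ℝ}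
    (ht : 0 < t) : fderiv ℝ P (t • ξ) = fderiv ℝ P ξ := by
  have h1 : fderiv ℝ (fun z => P (t • z)) ξ = t • fderiv ℝ P (t • ξ) := fderiv_comp_smul ..
  have h2 : fderiv ℝ (fun z => P (t • z)) ξ = t • fderiv ℝ P ξ := by
    have : (fun z => P (t • z)) = t • P := by
      ext z; simp [hP z t ht]
    rw [this, fderiv_const_smul_field, Pi.smul_apply]
  exact smul_right_injective _ ht.ne' (h1.symm.trans h2)

theorem norm_cons_const_le {E F : Type*} [NormedAddCommGroup E] [NormedSpace ℝ E]
    [NormedAddCommGroup F] [NormedSpace ℝ F] {k : ℕ}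
    (M : ContinuousMultilinearMap ℝ (fun _ : Fin (k + 1) => E) F) (w : E) {e : E} (he : ‖e‖ = 1) :
    ‖M (Fin.cons w (fun _ => e))‖ ≤ ‖M‖ * ‖w‖ := by
  refine (M.le_opNorm _).trans ?_
  rw [Fin.prod_univ_succ]
  simp [he]

/-- If the gradient of `h` vanishes on the ray through `e`, then the derivatives of `h` in the
direction `e` vanish to second order there. -/
theorem abs_iteratedFDeriv_le_of_fderiv_ray_eq_zero {E : Type} [NormedAddCommGroup E]
    [NormedSpace ℝ E] {h : E → ℝ} {U : Set E} (hU : IsOpen U) (hh : ContDiffOn ℝ ∞ h U)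
    {e ξ : E} (he : ‖e‖ = 1) {ρ : ℝ} (hρ : 0 < ρ) (hray : ∀ t : ℝ, 0 < t → fderiv ℝ h (t • e) = 0)
    (hseg : segment ℝ (ρ • e) ξ ⊆ U) {k : ℕ} {C : ℝ}
    (hC : ∀ q ∈ segment ℝ (ρ • e) ξ, ‖iteratedFDeriv ℝ (k + 3) h q‖ ≤ C) :
    ‖iteratedFDeriv ℝ (k + 1) h ξ (fun _ => e)‖ ≤ C * ‖ξ - ρ • e‖ ^ 2 := by
  have hpU : ρ • e ∈ U := hseg (left_mem_segment ..)
  have hdiff : ∀ l : ℕ, ∀ q ∈ U, DifferentiableAt ℝ (iteratedFDeriv ℝ l h) q := fun l q hq =>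
    (hh.contDiffAt (hU.mem_nhds hq)).differentiableAt_iteratedFDeriv
      (by exact_mod_cast WithTop.coe_lt_top _)
  have hh1 : ContDiffOn ℝ ∞ (fderiv ℝ h) U := hh.fderiv_of_isOpen hU (by simp)
  have hzero : ∀ (l : ℕ) (w : E),
      iteratedFDeriv ℝ (l + 1) h (ρ • e) (Fin.cons w (fun _ => e)) = 0 := by
    intro l w
    rw [iteratedFDeriv_succ_cons_const hU e w l hh _ hpU,
      ← iteratedFDerivWithin_of_isOpen l hU hpU, ← iteratedFDerivWithin_line hU hh1 hpU]
    have : iteratedFDerivWithin ℝ l (fun t : ℝ => fderiv ℝ h (ρ • e + t • e))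
        {t : ℝ | ρ • e + t • e ∈ U} 0 = iteratedFDerivWithin ℝ l (fun t : ℝ => (0 : E →L[ℝ] ℝ))
        {t : ℝ | ρ • e + t • e ∈ U} 0 := by
      refine Filter.EventuallyEq.iteratedFDerivWithin_eq ?_ ?_ l
      · refine Filter.Eventually.filter_mono nhdsWithin_le_nhds ?_
        filter_upwards [lt_mem_nhds (show -ρ < 0 by linarith)] with t ht
        rw [← add_smul]
        exact hray _ (by linarith)
      · simpa using hray ρ hρ
    rw [this]
    have h0 : (fun _ : ℝ => (0 : E →L[ℝ] ℝ)) = 0 := rfl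
    rw [h0, iteratedFDerivWithin_zero]
    simp
  have hC0 : 0 ≤ C := (norm_nonneg _).trans (hC _ (left_mem_segment ..))
  have hconv : Convex ℝ (segment ℝ (ρ • e) ξ) := convex_segment _ _
  have hM : ∀ q ∈ segment ℝ (ρ • e) ξ,
      ‖iteratedFDeriv ℝ (k + 2) h q - iteratedFDeriv ℝ (k + 2) h (ρ • e)‖ ≤
        C * ‖ξ - ρ • e‖ := by
    intro q hq
    refine (hconv.norm_image_sub_le_of_norm_fderiv_le (𝕜 := ℝ) (C := C)
      (fun x hx => hdiff _ x (hseg hx)) (fun x hx => ?_) (left_mem_segment ..) hq).trans ?_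
    · rw [norm_fderiv_iteratedFDeriv]; exact hC x hx
    · have : ‖q - ρ • e‖ ≤ ‖ξ - ρ • e‖ := by
        obtain ⟨θ, hθ, rfl⟩ := (segment_eq_image' ℝ (ρ • e) ξ) ▸ hq
        rw [add_sub_cancel_left, norm_smul, Real.norm_of_nonneg hθ.1]
        exact mul_le_of_le_one_left (norm_nonneg _) hθ.2
      gcongr
  let L : ContinuousMultilinearMap ℝ (fun _ : Fin (k + 1) => E) ℝ →L[ℝ] ℝ :=
    ContinuousMultilinearMap.apply ℝ (fun _ : Fin (k + 1) => E) ℝ (fun _ => e)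
  have hderiv : ∀ q ∈ segment ℝ (ρ • e) ξ,
      ‖fderiv ℝ (fun z => L (iteratedFDeriv ℝ (k + 1) h z)) q‖ ≤ C * ‖ξ - ρ • e‖ := by
    intro q hq
    refine ContinuousLinearMap.opNorm_le_bound _ (by positivity) fun w => ?_
    have hd : fderiv ℝ (fun z => L (iteratedFDeriv ℝ (k + 1) h z)) q =
        L.comp (fderiv ℝ (iteratedFDeriv ℝ (k + 1) h) q) :=
      (L.hasFDerivAt.comp q (hdiff (k + 1) q (hseg hq)).hasFDerivAt).fderiv
    have he' : L (fderiv ℝ (iteratedFDeriv ℝ (k + 1) h) q w) =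
        iteratedFDeriv ℝ (k + 2) h q (Fin.cons w (fun _ => e)) := by
      rw [iteratedFDeriv_succ_apply_left]
      simp [L]
    rw [hd, ContinuousLinearMap.comp_apply, he', ← sub_zero (iteratedFDeriv ℝ (k + 2) h q _),
      ← hzero (k + 1) w, ← sub_apply]
    refine (norm_cons_const_le _ w he).trans ?_
    gcongr
    exact hM q hq
  have hfin := hconv.norm_image_sub_le_of_norm_fderiv_le (𝕜 := ℝ)
    (f := fun z => L (iteratedFDeriv ℝ (k + 1) h z))
    (fun x hx => L.differentiableAt.comp x (hdiff _ x (hseg hx))) hderiv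
    (left_mem_segment ..) (right_mem_segment ..)
  have hz := hzero k e
  have hcc : (Fin.cons e (fun _ : Fin k => e) : Fin (k + 1) → E) = fun _ => e := by
    ext i; refine Fin.cases ?_ (fun i => ?_) i <;> simp
  rw [hcc] at hz
  change ‖iteratedFDeriv ℝ (k + 1) h ξ (fun _ => e) -
    iteratedFDeriv ℝ (k + 1) h (ρ • e) (fun _ => e)‖ ≤ _ at hfin
  rw [hz, sub_zero] at hfin
  exact hfin.trans_eq (by ring)

/-- If the gradient of `h` vanishes at `p`, it is small near `p`. -/
theorem norm_iteratedFDeriv_one_le_of_fderiv_eq_zero {E : Type*} [NormedAddCommGroup E]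
    [NormedSpace ℝ E] {h : E → ℝ} {U : Set E} (hU : IsOpen U) (hh : ContDiffOn ℝ ∞ h U)
    {p ξ : E} (hp : fderiv ℝ h p = 0) (hseg : segment ℝ p ξ ⊆ U) {C : ℝ}
    (hC : ∀ q ∈ segment ℝ p ξ, ‖iteratedFDeriv ℝ 2 h q‖ ≤ C) :
    ‖iteratedFDeriv ℝ 1 h ξ‖ ≤ C * ‖ξ - p‖ := by
  have hdiff : ∀ q ∈ U, DifferentiableAt ℝ (iteratedFDeriv ℝ 1 h) q := fun q hq =>
    (hh.contDiffAt (hU.mem_nhds hq)).differentiableAt_iteratedFDeriv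
      (by exact_mod_cast WithTop.coe_lt_top _)
  have := (convex_segment p ξ).norm_image_sub_le_of_norm_fderiv_le (𝕜 := ℝ) (C := C)
    (fun x hx => hdiff x (hseg hx)) (fun x hx => by rw [norm_fderiv_iteratedFDeriv]; exact hC x hx)
    (left_mem_segment ..) (right_mem_segment ..)
  have h0 : iteratedFDeriv ℝ 1 h p = 0 := by
    ext m; simp [hp]
  rwa [h0, sub_zero] at this

end HomogeneousPhase

section OscillatoryIntegral

open scoped FourierTransform

variable {E : Type*} [NormedAddCommGroup E] [InnerProductSpace ℝ E] [FiniteDimensional ℝ E]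
  [MeasurableSpace E] [BorelSpace E]

/-- Non-stationary phase: repeated integration by parts in the direction `v`. -/
theorem norm_integral_exp_inner_mul_pow {b : E → ℂ} (hb : ContDiff ℝ ∞ b)
    (hsupp : HasCompactSupport b) (g v : E) (k : ℕ) :
    |⟪g, v⟫_ℝ| ^ k * ‖∫ ξ, Complex.exp (Complex.I * ((⟪g, ξ⟫_ℝ : ℝ) : ℂ)) * b ξ‖ =
      ‖∫ ξ, Complex.exp (Complex.I * ((⟪g, ξ⟫_ℝ : ℝ) : ℂ)) *
        iteratedFDeriv ℝ k b ξ (fun _ => v)‖ := by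
  have hint : ∀ l : ℕ, (l : ℕ∞) ≤ ⊤ → Integrable (iteratedFDeriv ℝ l b) := fun l _ =>
    (hb.continuous_iteratedFDeriv (by exact_mod_cast le_top)).integrable_of_hasCompactSupport
      (hsupp.iteratedFDeriv l)
  set w : E := -((2 * Real.pi)⁻¹ • g) with hw
  have hF : ∀ f : E → ℂ, 𝓕 f w = ∫ ξ, Complex.exp (Complex.I * ((⟪g, ξ⟫_ℝ : ℝ) : ℂ)) * f ξ := by
    intro f
    rw [Real.fourier_eq']
    congr 1
    ext ξ
    rw [smul_eq_mul]
    congr 2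
    rw [mul_comm, hw, inner_neg_right, inner_smul_right, real_inner_comm]
    congr 2
    field_simp
  have key := congrFun (Real.fourier_iteratedFDeriv (N := ⊤) hb hint (n := k) le_top) w
  have key2 := congrArg (fun M => M (fun _ => v)) key
  rw [Real.fourier_continuousMultilinearMap_apply (hint k le_top), hF,
    VectorFourier.fourierPowSMulRight_apply, hF] at key2
  rw [key2, norm_smul, norm_smul, norm_pow, norm_neg, ← mul_assoc]
  congr 1
  simp only [neg_apply, Finset.prod_const, Finset.card_univ, Fintype.card_fin, norm_pow,
    ← mul_pow, hw]
  congr 1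
  simp [abs_of_pos Real.pi_pos]
  field_simp
  rfl

theorem pow_mul_norm_integral_exp_inner_le {b : E → ℂ} (hb : ContDiff ℝ ∞ b) {S : Set E}
    (hSc : IsCompact S) (hS : ∀ ξ, b ξ ≠ 0 → ξ ∈ S) (g v : E) (k : ℕ) {M V : ℝ}
    (hM : ∀ ξ ∈ S, ‖iteratedFDeriv ℝ k b ξ (fun _ => v)‖ ≤ M) (hM0 : 0 ≤ M)
    (hV : volume S ≤ ENNReal.ofReal V) (hV0 : 0 ≤ V) :
    |⟪g, v⟫_ℝ| ^ k * ‖∫ ξ, Complex.exp (Complex.I * ((⟪g, ξ⟫_ℝ : ℝ) : ℂ)) * b ξ‖ ≤ M * V := by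
  have hts : tsupport b ⊆ S := closure_minimal (fun ξ hξ => hS ξ hξ) hSc.isClosed
  rw [norm_integral_exp_inner_mul_pow hb (hSc.of_isClosed_subset isClosed_closure hts)]
  have hzero : ∀ ξ, ξ ∉ S → Complex.exp (Complex.I * ((⟪g, ξ⟫_ℝ : ℝ) : ℂ)) *
        iteratedFDeriv ℝ k b ξ (fun _ => v) = 0 := by
    intro ξ hξ
    have : iteratedFDeriv ℝ k b ξ = 0 := by
      by_contra hne
      exact hξ (hts (support_iteratedFDeriv_subset k hne))
    simp [this]
  rw [← setIntegral_eq_integral_of_forall_compl_eq_zero hzero]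
  refine (norm_setIntegral_le_of_norm_le_const hSc.measure_lt_top (C := M) fun ξ hξ => ?_).trans ?_
  · rw [norm_mul, mul_comm Complex.I, Complex.norm_exp_ofReal_mul_I, one_mul]
    exact hM ξ hξ
  · refine mul_le_mul_of_nonneg_left ?_ hM0
    exact ENNReal.toReal_le_of_le_ofReal hV0 hV

/-- The volume of a tube of length `a` along `e` and radius `b`. -/
theorem volume_tube_le {e : E} (he : ‖e‖ = 1) {a b : ℝ} (ha : 0 < a) (hb : 0 < b) :
    volume {ξ : E | |⟪ξ, e⟫_ℝ| ≤ a ∧ ‖ξ - ⟪ξ, e⟫_ℝ • e‖ ≤ b} ≤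
      ENNReal.ofReal (b ^ Module.finrank ℝ E * (a / b)) *
        volume (Metric.closedBall (0 : E) 2) := by
  have hee : ⟪e, e⟫_ℝ = 1 := by rw [real_inner_self_eq_norm_sq, he, one_pow]
  let A : E →ₗ[ℝ] E := b • LinearMap.transvection (((a - b) / b) • (innerSL ℝ e).toLinearMap) e
  have hdet : LinearMap.det A = b ^ Module.finrank ℝ E * (a / b) := by
    rw [LinearMap.det_smul, LinearMap.transvection.det]
    congr 1
    simp only [LinearMap.smul_apply, ContinuousLinearMap.coe_coe, innerSL_apply_apply, hee,
      smul_eq_mul]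
    field_simp
    ring
  have hA : ∀ z, A z = b • z + ((a - b) * ⟪e, z⟫_ℝ) • e := by
    intro z
    simp only [A, LinearMap.smul_apply, LinearMap.transvection.apply, smul_add, smul_smul,
      ContinuousLinearMap.coe_coe, innerSL_apply_apply, smul_eq_mul]
    congr 2
    field_simp
  have hsub : {ξ : E | |⟪ξ, e⟫_ℝ| ≤ a ∧ ‖ξ - ⟪ξ, e⟫_ℝ • e‖ ≤ b} ⊆
      A '' Metric.closedBall (0 : E) 2 := by
    rintro ξ ⟨h1, h2⟩
    refine ⟨(⟪ξ, e⟫_ℝ / a) • e + b⁻¹ • (ξ - ⟪ξ, e⟫_ℝ • e), ?_, ?_⟩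
    · rw [mem_closedBall_zero_iff]
      refine (norm_add_le _ _).trans ?_
      rw [norm_smul, norm_smul, he, mul_one, norm_div, norm_inv, Real.norm_eq_abs,
        Real.norm_of_nonneg ha.le, Real.norm_of_nonneg hb.le]
      have h3 : |⟪ξ, e⟫_ℝ| / a ≤ 1 := (div_le_one ha).2 h1
      have h4 : b⁻¹ * ‖ξ - ⟪ξ, e⟫_ℝ • e‖ ≤ 1 := by
        rw [inv_mul_le_iff₀ hb]; simpa using h2
      linarith
    · rw [hA]
      have h5 : ⟪e, (⟪ξ, e⟫_ℝ / a) • e + b⁻¹ • (ξ - ⟪ξ, e⟫_ℝ • e)⟫_ℝ = ⟪ξ, e⟫_ℝ / a := by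
        rw [inner_add_right, inner_smul_right, inner_smul_right, inner_sub_right,
          inner_smul_right, hee, real_inner_comm e ξ]
        ring
      rw [h5, smul_add, smul_smul b, smul_smul b, mul_inv_cancel₀ hb.ne', one_smul]
      have h6 : ξ - ⟪ξ, e⟫_ℝ • e = ξ + (-⟪ξ, e⟫_ℝ) • e := by rw [neg_smul, sub_eq_add_neg]
      have h7 : (b * (⟪ξ, e⟫_ℝ / a)) • e + (ξ + (-⟪ξ, e⟫_ℝ) • e) +
          ((a - b) * (⟪ξ, e⟫_ℝ / a)) • e =
          ξ + (b * (⟪ξ, e⟫_ℝ / a) + -⟪ξ, e⟫_ℝ + (a - b) * (⟪ξ, e⟫_ℝ / a)) • e := by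
        rw [add_smul, add_smul]; abel
      have h8 : b * (⟪ξ, e⟫_ℝ / a) + -⟪ξ, e⟫_ℝ + (a - b) * (⟪ξ, e⟫_ℝ / a) = 0 := by
        field_simp; ring
      rw [h6, h7, h8, zero_smul, add_zero]
  refine (measure_mono hsub).trans ?_
  rw [Measure.addHaar_image_linearMap, hdet, abs_of_pos (by positivity)]

end OscillatoryIntegral

section DyadicCone

variable {E : Type*} [NormedAddCommGroup E] [InnerProductSpace ℝ E]

/-- The part at distance about `X` from the origin of the cone of aperture `2 * ε` around `e`. -/
def dyadicCone (e : E) (X ε : ℝ) : Set E :=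
  {ξ | X / 2 ≤ ‖ξ‖ ∧ ‖ξ‖ ≤ 2 * X ∧ ‖ξ - ‖ξ‖ • e‖ ≤ 2 * ε * ‖ξ‖}

theorem isCompact_dyadicCone [FiniteDimensional ℝ E] (e : E) (X ε : ℝ) :
    IsCompact (dyadicCone e X ε) := by
  refine (isCompact_closedBall (0 : E) (2 * X)).of_isClosed_subset ?_ fun ξ hξ => by
    simpa using hξ.2.1
  exact (isClosed_le continuous_const continuous_norm).inter
    ((isClosed_le continuous_norm continuous_const).inter
      (isClosed_le (f := fun ξ : E => ‖ξ - ‖ξ‖ • e‖) (g := fun ξ => 2 * ε * ‖ξ‖) (by fun_prop)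
        (by fun_prop)))

theorem ne_zero_of_mem_dyadicCone {e ξ : E} {X ε : ℝ} (hX : 0 < X) (hξ : ξ ∈ dyadicCone e X ε) :
    ξ ≠ 0 := by
  have := hξ.1
  exact norm_pos_iff.1 (by linarith)

theorem norm_sub_inner_smul_le {e : E} (he : ‖e‖ = 1) (ξ : E) (s : ℝ) :
    ‖ξ - ⟪ξ, e⟫_ℝ • e‖ ≤ ‖ξ - s • e‖ := by
  refine le_of_sq_le_sq ?_ (norm_nonneg _)
  rw [norm_sub_sq_real, norm_sub_sq_real, inner_smul_right, inner_smul_right, norm_smul, norm_smul,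
    he, mul_one, mul_one, Real.norm_eq_abs, Real.norm_eq_abs, sq_abs, sq_abs]
  nlinarith [sq_nonneg (⟪ξ, e⟫_ℝ - s)]

theorem volume_dyadicCone_le [FiniteDimensional ℝ E] [MeasurableSpace E] [BorelSpace E] {e : E}
    (he : ‖e‖ = 1) {X ε : ℝ} (hX : 0 < X) (hε : 0 < ε) :
    volume (dyadicCone e X ε) ≤
      ENNReal.ofReal ((4 * ε * X) ^ Module.finrank ℝ E * (2 * X / (4 * ε * X))) *
        volume (Metric.closedBall (0 : E) 2) := by
  have hsub : dyadicCone e X ε ⊆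
      {ξ | |⟪ξ, e⟫_ℝ| ≤ 2 * X ∧ ‖ξ - ⟪ξ, e⟫_ℝ • e‖ ≤ 4 * ε * X} := ?_
  · exact (measure_mono hsub).trans (volume_tube_le he (by positivity) (by positivity))
  refine fun ξ hξ => ⟨?_, ?_⟩
  · refine (abs_real_inner_le_norm _ _).trans ?_
    rw [he, mul_one]
    exact hξ.2.1
  · refine (norm_sub_inner_smul_le he ξ ‖ξ‖).trans (hξ.2.2.trans ?_)
    nlinarith [mul_le_mul_of_nonneg_left hξ.2.1 hε.le]

/-- Segments from the axis of the cone stay away from the origin. -/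
theorem le_norm_of_mem_segment_dyadicCone {e ξ q : E} (he : ‖e‖ = 1) {X ε : ℝ} (hX : 0 < X)
    (hε2 : ε ^ 2 ≤ 1 / 2) (hξ : ξ ∈ dyadicCone e X ε)
    (hq : q ∈ segment ℝ (‖ξ‖ • e) ξ) : X / 4 ≤ ‖q‖ := by
  obtain ⟨h1, -, h3⟩ := hξ
  set ρ := ‖ξ‖ with hρ
  have hρ0 : 0 < ρ := by linarith
  have hin : 0 ≤ ⟪ξ, e⟫_ℝ := by
    have h4 : ‖ξ - ρ • e‖ ^ 2 ≤ (2 * ε * ρ) ^ 2 := by gcongr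
    rw [norm_sub_sq_real, inner_smul_right, norm_smul, he, mul_one, Real.norm_of_nonneg hρ0.le,
      ← hρ] at h4
    have h5 : (2 * ε * ρ) ^ 2 ≤ 2 * ρ ^ 2 := by nlinarith [sq_nonneg ρ]
    nlinarith
  obtain ⟨s, t, hs, ht, hst, rfl⟩ := hq
  have hsq : (ρ / 2) ^ 2 ≤ ‖s • ρ • e + t • ξ‖ ^ 2 := by
    rw [norm_add_sq_real, norm_smul, norm_smul, norm_smul, he, mul_one, ← hρ, inner_smul_left,
      inner_smul_left, inner_smul_right, real_inner_comm, Real.norm_of_nonneg hs,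
      Real.norm_of_nonneg ht, Real.norm_of_nonneg hρ0.le]
    simp only [conj_trivial]
    have h6 : 0 ≤ s * (ρ * (t * ⟪ξ, e⟫_ℝ)) := by positivity
    have h7 : (s * ρ) ^ 2 + (t * ρ) ^ 2 = ρ ^ 2 * (s ^ 2 + t ^ 2) := by ring
    have h8 : 1 / 4 ≤ s ^ 2 + t ^ 2 := by nlinarith [sq_nonneg (s - t)]
    have h9 : ρ ^ 2 * (1 / 4) ≤ ρ ^ 2 * (s ^ 2 + t ^ 2) := by gcongr
    nlinarith
  have := le_of_sq_le_sq hsq (norm_nonneg _)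
  linarith

end DyadicCone

section Linearization

/-- Subtracting a continuous linear map does not change the derivatives of order at least two. -/
theorem iteratedFDeriv_sub_clm {E F : Type*} [NormedAddCommGroup E] [NormedSpace ℝ E]
    [NormedAddCommGroup F] [NormedSpace ℝ F] {P : E → F} {x : E} (hP : ContDiffAt ℝ ∞ P x)
    (L : E →L[ℝ] F) (k : ℕ) :
    iteratedFDeriv ℝ (k + 2) (fun y => P y - L y) x = iteratedFDeriv ℝ (k + 2) P x := by
  have h0 : iteratedFDeriv ℝ (k + 2) (fun y => L y) x = 0 := by
    rw [← norm_eq_zero, ← norm_iteratedFDeriv_fderiv]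
    have : fderiv ℝ (fun y => L y) = fun _ => L := by ext1 y; exact L.fderiv
    rw [this, iteratedFDeriv_const_of_ne (by omega)]
    simp
  have := iteratedFDeriv_sub_apply (i := k + 2) (hP.of_le ENat.LEInfty.out)
    L.contDiff.contDiffAt (x := x)
  change iteratedFDeriv ℝ (k + 2) (P - fun y => L y) x = _
  rw [this, h0, sub_zero]

/-- The linearized phase is of size one on a dyadic cone, together with its derivatives of scale
`X⁻¹` in the direction of the axis and of scale `X⁻¹ᐟ²` in the other directions. -/
theorem exists_norm_linearizedPhase_le (Cφ : ℕ → ℝ) (k : ℕ) :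
    ∃ c : ℝ, 1 ≤ c ∧ ∀ {E : Type} [NormedAddCommGroup E] [InnerProductSpace ℝ E] (P : E → ℝ)
      (e v ξ : E) (X ε r : ℝ), ContDiffOn ℝ ∞ P {ξ | ξ ≠ 0} →
      (∀ (ξ : E) (t : ℝ), 0 < t → P (t • ξ) = t * P ξ) →
      (∀ l, 1 ≤ l → ∀ ξ : E, ξ ≠ 0 → ‖ξ‖ ^ l * ‖iteratedFDeriv ℝ (l + 1) P ξ‖ ≤ Cφ (l + 1)) →
      ‖e‖ = 1 → ‖v‖ ≤ 1 → 0 < X → 0 < ε → X * ε ^ 2 = 1 → ε ^ 2 ≤ 1 / 2 →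
      (v = e ∧ r = ε ^ 2 ∨ r = ε) → ξ ∈ dyadicCone e X ε → ∀ i, 1 ≤ i → i ≤ k →
        ‖iteratedFDerivWithin ℝ i (fun z => P z - fderiv ℝ P e z) {ξ | ξ ≠ 0} ξ (fun _ => v)‖ ≤
          c * r ^ i := by
  set B : ℕ → ℝ := fun i => 16 * 4 ^ (i + 1) * (|Cφ (i + 2)| + |Cφ i| + |Cφ 2|) with hB
  have hB0 : ∀ i, 0 ≤ B i := fun i => by simp only [hB]; positivity
  refine ⟨1 + ∑ i ∈ Finset.range (k + 1), B i, ?_, ?_⟩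
  · have := Finset.sum_nonneg fun i (_ : i ∈ Finset.range (k + 1)) => hB0 i
    linarith
  intro E _ _ P e v ξ X ε r hP hhom hPb he hv hX hε hXε hε2 hr hξ i hi1 hik
  have hU : IsOpen {ξ : E | ξ ≠ 0} := isOpen_ne
  have hr0 : 0 ≤ r := by rcases hr with ⟨_, rfl⟩ | rfl <;> positivity
  suffices h : ‖iteratedFDerivWithin ℝ i (fun z => P z - fderiv ℝ P e z) {ξ | ξ ≠ 0} ξ
      (fun _ => v)‖ ≤ B i * r ^ i by
    refine h.trans ?_
    gcongr
    have := Finset.single_le_sum (fun i _ => hB0 i)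
      (Finset.mem_range.2 (Nat.lt_succ_of_le hik))
    linarith
  set h : E → ℝ := fun z => P z - fderiv ℝ P e z with hh
  have hhc : ContDiffOn ℝ ∞ h {ξ | ξ ≠ 0} := hP.sub (fderiv ℝ P e).contDiff.contDiffOn
  have hray : ∀ t : ℝ, 0 < t → fderiv ℝ h (t • e) = 0 := by
    intro t ht
    have hte : t • e ∈ {ξ : E | ξ ≠ 0} :=
      smul_ne_zero ht.ne' (norm_pos_iff.1 (by rw [he]; exact one_pos))
    have hd : DifferentiableAt ℝ P (t • e) :=
      (hP.contDiffAt (hU.mem_nhds hte)).differentiableAt (by simp)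
    have := (hd.hasFDerivAt.sub (fderiv ℝ P e).hasFDerivAt).fderiv
    rw [fderiv_smul_of_homogeneous hhom e ht, sub_self] at this
    exact this
  have hξ0 : ξ ∈ {ξ : E | ξ ≠ 0} := ne_zero_of_mem_dyadicCone hX hξ
  have hρ : 0 < ‖ξ‖ := norm_pos_iff.2 hξ0
  have hfar : ∀ q ∈ segment ℝ (‖ξ‖ • e) ξ, X / 4 ≤ ‖q‖ := fun q hq =>
    le_norm_of_mem_segment_dyadicCone he hX hε2 hξ hq
  have hseg : segment ℝ (‖ξ‖ • e) ξ ⊆ {ξ : E | ξ ≠ 0} := fun q hq =>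
    norm_pos_iff.1 (by have := hfar q hq; linarith)
  have hXi : X⁻¹ = ε ^ 2 := by rw [inv_eq_iff_eq_inv]; field_simp; linarith
  have hhb : ∀ l, 1 ≤ l → ∀ q ∈ segment ℝ (‖ξ‖ • e) ξ,
      ‖iteratedFDeriv ℝ (l + 1) h q‖ ≤ |Cφ (l + 1)| * (4 * ε ^ 2) ^ l := by
    intro l hl q hq
    obtain ⟨l, rfl⟩ : ∃ l', l = l' + 1 := ⟨l - 1, by omega⟩
    rw [hh, iteratedFDeriv_sub_clm (hP.contDiffAt (hU.mem_nhds (hseg hq)))]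
    have h1 := hPb (l + 1) hl q (hseg hq)
    have h2 : (X / 4) ^ (l + 1) ≤ ‖q‖ ^ (l + 1) := by gcongr; exact hfar q hq
    have h3 : (X / 4) ^ (l + 1) * ‖iteratedFDeriv ℝ (l + 1 + 1) P q‖ ≤ |Cφ (l + 1 + 1)| :=
      (mul_le_mul_of_nonneg_right h2 (norm_nonneg _)).trans (h1.trans (le_abs_self _))
    have h4 : (4 * ε ^ 2) ^ (l + 1) * (X / 4) ^ (l + 1) = 1 := by
      rw [← mul_pow, ← hXi]; field_simp; exact one_pow _
    calc ‖iteratedFDeriv ℝ (l + 2) P q‖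
        = (4 * ε ^ 2) ^ (l + 1) * ((X / 4) ^ (l + 1) * ‖iteratedFDeriv ℝ (l + 2) P q‖) := by
          rw [← mul_assoc, h4, one_mul]
      _ ≤ (4 * ε ^ 2) ^ (l + 1) * |Cφ (l + 1 + 1)| := by gcongr
      _ = _ := mul_comm _ _
  have hu : ‖ξ - ‖ξ‖ • e‖ ≤ 4 * ε * X := by
    refine hξ.2.2.trans ?_
    nlinarith [mul_le_mul_of_nonneg_left hξ.2.1 hε.le]
  have hε1 : ε ≤ 1 := by nlinarith
  obtain ⟨l, rfl⟩ : ∃ l', i = l' + 1 := ⟨i - 1, by omega⟩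
  rw [iteratedFDerivWithin_of_isOpen _ hU hξ0]
  rcases hr with ⟨rfl, rfl⟩ | rfl
  · refine (abs_iteratedFDeriv_le_of_fderiv_ray_eq_zero hU hhc he hρ hray hseg (k := l)
      (hhb (l + 2) (by omega))).trans ?_
    have hε2X : ε ^ 2 * X = 1 := by rw [mul_comm]; exact hXε
    calc |Cφ (l + 2 + 1)| * (4 * ε ^ 2) ^ (l + 2) * ‖ξ - ‖ξ‖ • v‖ ^ 2
        ≤ |Cφ (l + 2 + 1)| * (4 * ε ^ 2) ^ (l + 2) * (4 * ε * X) ^ 2 := by gcongr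
      _ = 16 * 4 ^ (l + 1 + 1) * |Cφ (l + 1 + 2)| * (ε ^ 2) ^ (l + 1) *
          (ε ^ 2 * X) ^ 2 := by ring
      _ = 16 * 4 ^ (l + 1 + 1) * |Cφ (l + 1 + 2)| * (ε ^ 2) ^ (l + 1) := by
          rw [hε2X, one_pow, mul_one]
      _ ≤ B (l + 1) * (ε ^ 2) ^ (l + 1) := by
          simp only [hB]
          gcongr
          have := abs_nonneg (Cφ (l + 1)); have := abs_nonneg (Cφ 2)
          linarith
  · refine (ContinuousMultilinearMap.le_opNorm _ _).trans ((mul_le_of_le_one_right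
      (norm_nonneg _) (by simpa using pow_le_one₀ (norm_nonneg _) hv)).trans ?_)
    rcases Nat.eq_zero_or_pos l with rfl | hl
    · refine (norm_iteratedFDeriv_one_le_of_fderiv_eq_zero hU hhc (hray _ hρ) hseg
        (hhb 1 le_rfl)).trans ?_
      calc |Cφ (1 + 1)| * (4 * r ^ 2) ^ 1 * ‖ξ - ‖ξ‖ • e‖
          ≤ |Cφ (1 + 1)| * (4 * r ^ 2) ^ 1 * (4 * r * X) := by gcongr
        _ = 16 * |Cφ 2| * r * (X * r ^ 2) := by ring
        _ = 16 * |Cφ 2| * r := by rw [hXε, mul_one]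
        _ ≤ B (0 + 1) * r ^ (0 + 1) := by
          simp only [hB, zero_add, pow_one]
          refine mul_le_mul_of_nonneg_right ?_ hε.le
          have := abs_nonneg (Cφ (1 + 2)); have := abs_nonneg (Cφ 1); have := abs_nonneg (Cφ 2)
          norm_num
          linarith
    · refine (hhb l hl ξ (right_mem_segment ..)).trans ?_
      have h1 : (r ^ 2) ^ l ≤ r ^ (l + 1) := by
        rw [← pow_mul]
        exact pow_le_pow_of_le_one hε.le hε1 (by omega)
      calc |Cφ (l + 1)| * (4 * r ^ 2) ^ l = 4 ^ l * |Cφ (l + 1)| * (r ^ 2) ^ l := by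
            rw [mul_pow]; ring
        _ ≤ 4 ^ l * |Cφ (l + 1)| * r ^ (l + 1) := by gcongr
        _ ≤ B (l + 1) * r ^ (l + 1) := by
            simp only [hB]
            refine mul_le_mul_of_nonneg_right ?_ (by positivity)
            have h4 : (4 : ℝ) ^ l ≤ 4 ^ (l + 1 + 1) :=
              pow_le_pow_right₀ (by norm_num) (by omega)
            have := abs_nonneg (Cφ (l + 1)); have := abs_nonneg (Cφ 2)
            have := abs_nonneg (Cφ (l + 1 + 2))
            calc (4 : ℝ) ^ l * |Cφ (l + 1)| ≤ 4 ^ (l + 1 + 1) * |Cφ (l + 1)| := by gcongr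
              _ ≤ 16 * 4 ^ (l + 1 + 1) * |Cφ (l + 1)| := by
                have : (0 : ℝ) ≤ 4 ^ (l + 1 + 1) * |Cφ (l + 1)| := by positivity
                linarith
              _ ≤ _ := by gcongr; linarith

end Linearization

section Amplitude

theorem DirBound.of_seq {E F : Type*} [NormedAddCommGroup E] [NormedSpace ℝ E]
    [NormedAddCommGroup F] [NormedSpace ℝ F] {U : Set E} {f : E → F} {x v : E} {r Y : ℝ} {k : ℕ}
    (B : ℕ → ℝ) (hr : 0 ≤ r) (hY : 0 ≤ Y)
    (h : ∀ i ≤ k, ‖iteratedFDerivWithin ℝ i f U x (fun _ => v)‖ ≤ B i * Y * r ^ i) :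
    DirBound U f x v r k ((∑ i ∈ Finset.range (k + 1), |B i|) * Y) := by
  intro i hi
  refine (h i hi).trans ?_
  gcongr
  exact (le_abs_self _).trans (Finset.single_le_sum (f := fun i => |B i|)
    (fun i _ => abs_nonneg _) (Finset.mem_range.2 (Nat.lt_succ_of_le hi)))

theorem rpow_le_mul_rpow_of_comparable {t s L : ℝ} (hs : 0 < s) (hL : 1 ≤ L) (h1 : s / L ≤ t)
    (h2 : t ≤ L * s) (q : ℝ) : t ^ q ≤ L ^ |q| * s ^ q := by
  have hL0 : 0 < L := by linarith
  have ht : 0 < t := lt_of_lt_of_le (by positivity) h1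
  rcases le_total 0 q with hq | hq
  · rw [abs_of_nonneg hq, ← Real.mul_rpow hL0.le hs.le]
    exact Real.rpow_le_rpow ht.le h2 hq
  · rw [abs_of_nonpos hq, Real.rpow_neg hL0.le, ← Real.inv_rpow hL0.le,
      ← Real.mul_rpow (by positivity) hs.le]
    refine Real.rpow_le_rpow_of_nonpos (by positivity) ?_ hq
    rwa [inv_mul_eq_div]

variable {n : ℕ} {ψ0 : Rn n → ℝ}

theorem lpPiece_eq_of_pos (ψ0 : Rn n → ℝ) {j : ℕ} (hj : 1 ≤ j) :
    lpPiece n ψ0 j = fun ξ => ψ0 (((2 : ℝ) ^ j)⁻¹ • ξ) - ψ0 ((2 * ((2 : ℝ) ^ j)⁻¹) • ξ) := by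
  ext ξ
  rw [lpPiece, if_neg (by omega), zpow_add₀ two_ne_zero, zpow_neg, zpow_natCast, zpow_one, mul_comm]

theorem contDiff_lpPiece (hψ0 : IsLPBase n ψ0) {j : ℕ} (hj : 1 ≤ j) :
    ContDiff ℝ ((⊤ : ℕ∞) : WithTop ℕ∞) (lpPiece n ψ0 j) := by
  rw [lpPiece_eq_of_pos ψ0 hj]
  exact (hψ0.1.comp (contDiff_const_smul _)).sub (hψ0.1.comp (contDiff_const_smul _))

theorem norm_mem_of_lpPiece_ne_zero (hψ0 : IsLPBase n ψ0) {j : ℕ} (hj : 1 ≤ j) {ξ : Rn n}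
    (h : lpPiece n ψ0 j ξ ≠ 0) : (2 : ℝ) ^ j / 2 ≤ ‖ξ‖ ∧ ‖ξ‖ ≤ 2 * 2 ^ j := by
  have hX : (0 : ℝ) < 2 ^ j := by positivity
  rw [lpPiece_eq_of_pos ψ0 hj] at h
  have e1 : ‖((2 : ℝ) ^ j)⁻¹ • ξ‖ = ‖ξ‖ / 2 ^ j := by
    rw [norm_smul, Real.norm_of_nonneg (by positivity)]; field_simp
  have e2 : ‖(2 * ((2 : ℝ) ^ j)⁻¹) • ξ‖ = 2 * ‖ξ‖ / 2 ^ j := by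
    rw [norm_smul, Real.norm_of_nonneg (by positivity)]; field_simp
  constructor
  · by_contra! hlt
    refine h ?_
    change ψ0 _ - ψ0 _ = 0
    rw [hψ0.2.1 _ (by rw [e1, div_le_one hX]; linarith [norm_nonneg ξ]),
      hψ0.2.1 _ (by rw [e2, div_le_one hX]; linarith), sub_self]
  · by_contra! hlt
    refine h ?_
    change ψ0 _ - ψ0 _ = 0
    rw [hψ0.2.2 _ (by rw [e1, lt_div_iff₀ hX]; linarith),
      hψ0.2.2 _ (by rw [e2, lt_div_iff₀ hX]; linarith [norm_nonneg ξ]), sub_self]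

theorem IsLPBase.exists_norm_iteratedFDeriv_lpPiece_le (hψ0 : IsLPBase n ψ0) :
    ∃ B : ℕ → ℝ, ∀ j, 1 ≤ j → ∀ (i : ℕ) (ξ : Rn n),
      ‖iteratedFDeriv ℝ i (lpPiece n ψ0 j) ξ‖ ≤ B i * (((2 : ℝ) ^ j)⁻¹) ^ i := by
  have hcs : HasCompactSupport ψ0 := by
    refine HasCompactSupport.intro (isCompact_closedBall (0 : Rn n) 2) fun ξ hξ => hψ0.2.2 ξ ?_
    simpa using hξ
  have hb : ∀ i : ℕ, ∃ C, ∀ ξ, ‖iteratedFDeriv ℝ i ψ0 ξ‖ ≤ C := fun i =>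
    (hcs.iteratedFDeriv i).exists_bound_of_continuous
      (hψ0.1.continuous_iteratedFDeriv (by exact_mod_cast le_top))
  choose C hC using hb
  have hsm : ∀ (c : ℝ) (i : ℕ) (ξ : Rn n), 0 ≤ c →
      ‖iteratedFDeriv ℝ i (fun ξ => ψ0 (c • ξ)) ξ‖ ≤ c ^ i * C i := by
    intro c i ξ hc
    rw [iteratedFDeriv_comp_const_smul c (hψ0.1.of_le (by exact_mod_cast le_top)), norm_smul,
      norm_pow, Real.norm_of_nonneg hc]
    gcongr
    exact hC i _
  refine ⟨fun i => (1 + 2 ^ i) * C i, fun j hj i ξ => ?_⟩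
  have hcd : ∀ c : ℝ, ContDiffAt ℝ i (fun ξ : Rn n => ψ0 (c • ξ)) ξ := fun c =>
    ((hψ0.1.comp (contDiff_const_smul c)).of_le (by exact_mod_cast le_top)).contDiffAt
  rw [lpPiece_eq_of_pos ψ0 hj]
  have := iteratedFDeriv_sub_apply (hcd ((2 : ℝ) ^ j)⁻¹) (hcd (2 * ((2 : ℝ) ^ j)⁻¹))
  change ‖iteratedFDeriv ℝ i ((fun ξ => ψ0 (((2 : ℝ) ^ j)⁻¹ • ξ)) -
    fun ξ => ψ0 ((2 * ((2 : ℝ) ^ j)⁻¹) • ξ)) ξ‖ ≤ _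
  rw [this]
  refine (norm_sub_le _ _).trans ((add_le_add (hsm _ i ξ (by positivity))
    (hsm _ i ξ (by positivity))).trans (le_of_eq ?_))
  rw [mul_pow]
  ring

end Amplitude

section AmplitudeBounds

variable {n : ℕ} {e v ξ : Rn n} {X ε r : ℝ}

theorem inv_norm_le_of_mem_dyadicCone (hX : 0 < X) (hXε : X * ε ^ 2 = 1)
    (hξ : ξ ∈ dyadicCone e X ε) : ‖ξ‖⁻¹ ≤ 2 * ε ^ 2 := by
  have h1 := hξ.1
  have hρ : 0 < ‖ξ‖ := by linarith
  rw [inv_le_iff_one_le_mul₀ hρ]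
  have : 2 * ε ^ 2 * (X / 2) ≤ 2 * ε ^ 2 * ‖ξ‖ := by gcongr
  nlinarith

theorem norm_apply_const_le {F : Type*} [NormedAddCommGroup F] [NormedSpace ℝ F] {k : ℕ}
    (M : ContinuousMultilinearMap ℝ (fun _ : Fin k => Rn n) F) (hv : ‖v‖ ≤ 1) :
    ‖M (fun _ => v)‖ ≤ ‖M‖ :=
  (M.le_opNorm _).trans (mul_le_of_le_one_right (norm_nonneg _)
    (by simpa using pow_le_one₀ (norm_nonneg _) hv))

theorem dirBound_cutoff {χ : Rn n → ℝ} {Cχ CχN : ℕ → ℝ} (hX : 0 < X) (hε : 0 < ε)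
    (hXε : X * ε ^ 2 = 1) (hv : ‖v‖ ≤ 1) (hr : v = e ∧ r = ε ^ 2 ∨ r = ε)
    (hχ : ∀ k : ℕ, ∀ ξ : Rn n, ξ ≠ 0 →
      ‖iteratedFDerivWithin ℝ k χ {ξ' : Rn n | ξ' ≠ 0} ξ‖ ≤ Cχ k * ε⁻¹ ^ k * ‖ξ‖⁻¹ ^ k)
    (hχN : ∀ k : ℕ, 1 ≤ k → ∀ ξ : Rn n, ξ ≠ 0 →
      |iteratedFDerivWithin ℝ k χ {ξ' : Rn n | ξ' ≠ 0} ξ (fun _ => e)| ≤ CχN k * ‖ξ‖⁻¹ ^ k)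
    (hξ : ξ ∈ dyadicCone e X ε) (k : ℕ) :
    DirBound {ξ' : Rn n | ξ' ≠ 0} χ ξ v r k
      ((∑ i ∈ Finset.range (k + 1), |2 ^ i * (|Cχ i| + |CχN i|)|) * 1) := by
  have hξ0 : ξ ≠ 0 := ne_zero_of_mem_dyadicCone hX hξ
  have hinv := inv_norm_le_of_mem_dyadicCone hX hXε hξ
  have hr0 : 0 ≤ r := by rcases hr with ⟨_, rfl⟩ | rfl <;> positivity
  refine DirBound.of_seq _ hr0 zero_le_one fun i _ => ?_
  rw [mul_one]
  have hgen : ‖iteratedFDerivWithin ℝ i χ {ξ' : Rn n | ξ' ≠ 0} ξ (fun _ => v)‖ ≤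
      2 ^ i * |Cχ i| * ε ^ i := by
    refine (norm_apply_const_le _ hv).trans ((hχ i ξ hξ0).trans ?_)
    calc Cχ i * ε⁻¹ ^ i * ‖ξ‖⁻¹ ^ i ≤ |Cχ i| * ε⁻¹ ^ i * (2 * ε ^ 2) ^ i := by
          gcongr; exact le_abs_self _
      _ = |Cχ i| * (ε⁻¹ * (2 * ε ^ 2)) ^ i := by rw [mul_pow]; ring
      _ = _ := by
          rw [show ε⁻¹ * (2 * ε ^ 2) = 2 * ε by field_simp, mul_pow]; ring
  rcases hr with ⟨rfl, rfl⟩ | rfl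
  · rcases Nat.eq_zero_or_pos i with rfl | hi
    · refine hgen.trans ?_
      simp
    · rw [Real.norm_eq_abs]
      refine (hχN i hi ξ hξ0).trans ?_
      calc CχN i * ‖ξ‖⁻¹ ^ i ≤ |CχN i| * (2 * ε ^ 2) ^ i := by
            gcongr; exact le_abs_self _
        _ = 2 ^ i * |CχN i| * (ε ^ 2) ^ i := by rw [mul_pow]; ring
        _ ≤ _ := by gcongr; linarith [abs_nonneg (Cχ i)]
  · refine hgen.trans ?_
    gcongr
    linarith [abs_nonneg (CχN i)]

theorem dirBound_symbol {a : Rn n → ℂ} {Ca : ℕ → ℝ} {m : ℝ} (hX : 1 ≤ X)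
    (hXε : X * ε ^ 2 = 1) (hv : ‖v‖ ≤ 1) (hr : ε ^ 2 ≤ r)
    (ha : ∀ (k : ℕ) (ξ : Rn n),
      ‖iteratedFDeriv ℝ k a ξ‖ ≤ Ca k * (1 + ‖ξ‖ ^ 2) ^ ((m - (k : ℝ)) / 2))
    (hξ : ξ ∈ dyadicCone e X ε) (k : ℕ) :
    DirBound {ξ' : Rn n | ξ' ≠ 0} a ξ v r k
      ((∑ i ∈ Finset.range (k + 1), |(|Ca i| * 8 ^ |(m - (i : ℝ)) / 2|)|) * X ^ m) := by
  have hX0 : 0 < X := by linarith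
  have hξ0 : ξ ∈ {ξ' : Rn n | ξ' ≠ 0} := ne_zero_of_mem_dyadicCone hX0 hξ
  have hr0 : 0 ≤ r := (sq_nonneg ε).trans hr
  have hXi : X⁻¹ = ε ^ 2 := by rw [inv_eq_iff_eq_inv]; exact eq_inv_of_mul_eq_one_left hXε
  refine DirBound.of_seq _ hr0 (by positivity) fun i _ => ?_
  rw [iteratedFDerivWithin_of_isOpen _ isOpen_ne hξ0]
  refine (norm_apply_const_le _ hv).trans ((ha i ξ).trans ?_)
  obtain ⟨h1, h2, -⟩ := hξ
  have hc := rpow_le_mul_rpow_of_comparable (t := 1 + ‖ξ‖ ^ 2) (s := X ^ 2) (L := 8)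
    (by positivity) (by norm_num) (by nlinarith) (by nlinarith) ((m - (i : ℝ)) / 2)
  have hpow : (X ^ 2) ^ ((m - (i : ℝ)) / 2) = X ^ m * (ε ^ 2) ^ i := by
    rw [← Real.rpow_natCast X 2, ← Real.rpow_mul hX0.le, ← hXi, inv_pow, ← Real.rpow_natCast X i,
      ← Real.rpow_neg hX0.le, ← Real.rpow_add hX0]
    congr 1
    push_cast
    ring
  calc Ca i * (1 + ‖ξ‖ ^ 2) ^ ((m - (i : ℝ)) / 2)
      ≤ |Ca i| * (8 ^ |(m - (i : ℝ)) / 2| * (X ^ 2) ^ ((m - (i : ℝ)) / 2)) := by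
        gcongr
        exact le_abs_self _
    _ = |Ca i| * 8 ^ |(m - (i : ℝ)) / 2| * X ^ m * (ε ^ 2) ^ i := by rw [hpow]; ring
    _ ≤ _ := by gcongr

/-- The data entering the kernel of a second-dyadic piece: a cut-off `χ` to the cone of aperture
`2 * ε` around `e`, where `ε = 2 ^ (-j / 2)`, a phase `P` and a symbol `a` of order `m`. -/
structure SecondDyadicPiece (m : ℝ) (Ca Cφ Cχ CχN : ℕ → ℝ) (j : ℕ) (ε : ℝ) (e : Rn n)
    (χ P : Rn n → ℝ) (a : Rn n → ℂ) : Prop where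
  one_le : 1 ≤ j
  pos : 0 < ε
  mul_sq : (2 : ℝ) ^ j * ε ^ 2 = 1
  norm_eq : ‖e‖ = 1
  cutoff_contDiffOn : ContDiffOn ℝ (⊤ : ℕ∞) χ {ξ : Rn n | ξ ≠ 0}
  cutoff_support : ∀ ξ : Rn n, ξ ≠ 0 → χ ξ ≠ 0 → ‖‖ξ‖⁻¹ • ξ - e‖ ≤ 2 * ε
  cutoff_bound : ∀ k : ℕ, ∀ ξ : Rn n, ξ ≠ 0 →
    ‖iteratedFDerivWithin ℝ k χ {ξ' : Rn n | ξ' ≠ 0} ξ‖ ≤ Cχ k * ε⁻¹ ^ k * ‖ξ‖⁻¹ ^ k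
  cutoff_bound_axis : ∀ k : ℕ, 1 ≤ k → ∀ ξ : Rn n, ξ ≠ 0 →
    |iteratedFDerivWithin ℝ k χ {ξ' : Rn n | ξ' ≠ 0} ξ (fun _ => e)| ≤ CχN k * ‖ξ‖⁻¹ ^ k
  symbol_contDiff : ContDiff ℝ (⊤ : ℕ∞) a
  symbol_bound : ∀ (k : ℕ) (ξ : Rn n),
    ‖iteratedFDeriv ℝ k a ξ‖ ≤ Ca k * (1 + ‖ξ‖ ^ 2) ^ ((m - (k : ℝ)) / 2)
  phase_contDiffOn : ContDiffOn ℝ (⊤ : ℕ∞) P {ξ | ξ ≠ 0}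
  phase_homog : ∀ (ξ : Rn n) (t : ℝ), 0 < t → P (t • ξ) = t * P ξ
  phase_bound : ∀ l, 1 ≤ l → ∀ ξ : Rn n, ξ ≠ 0 →
    ‖ξ‖ ^ l * ‖iteratedFDeriv ℝ (l + 1) P ξ‖ ≤ Cφ (l + 1)

/-- The symbol of a second-dyadic piece, including the nonlinear part of the phase. -/
def pieceAmplitude (ψ0 : Rn n → ℝ) (j : ℕ) (e : Rn n) (χ P : Rn n → ℝ) (a : Rn n → ℂ)
    (ξ : Rn n) : ℂ :=
  Complex.exp (Complex.I * ((P ξ - fderiv ℝ P e ξ : ℝ) : ℂ)) *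
    ((lpPiece n ψ0 j ξ * χ ξ : ℝ) : ℂ) * a ξ

theorem exists_norm_iteratedFDeriv_pieceAmplitude_le (m : ℝ) {ψ0 : Rn n → ℝ}
    (hψ0 : IsLPBase n ψ0) (Ca Cφ Cχ CχN : ℕ → ℝ) (k : ℕ) :
    ∃ M : ℝ, 0 ≤ M ∧ ∀ (j : ℕ) (ε r : ℝ) (e v ξ : Rn n) (χ P : Rn n → ℝ) (a : Rn n → ℂ),
      SecondDyadicPiece m Ca Cφ Cχ CχN j ε e χ P a → ‖v‖ ≤ 1 → (v = e ∧ r = ε ^ 2 ∨ r = ε) →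
      ξ ∈ dyadicCone e (2 ^ j) ε →
      ‖iteratedFDeriv ℝ k (pieceAmplitude ψ0 j e χ P a) ξ (fun _ => v)‖ ≤
          M * ((2 : ℝ) ^ j) ^ m * r ^ k := by
  obtain ⟨B, hB⟩ := hψ0.exists_norm_iteratedFDeriv_lpPiece_le
  obtain ⟨c, hc1, hc⟩ := exists_norm_linearizedPhase_le Cφ k
  set Aψ := ∑ i ∈ Finset.range (k + 1), |B i| with hAψ
  set Aχ := ∑ i ∈ Finset.range (k + 1), |2 ^ i * (|Cχ i| + |CχN i|)| with hAχ
  set Aa := ∑ i ∈ Finset.range (k + 1), |(|Ca i| * 8 ^ |(m - (i : ℝ)) / 2|)| with hAa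
  have hAψ0 : 0 ≤ Aψ := Finset.sum_nonneg fun i _ => abs_nonneg _
  have hAχ0 : 0 ≤ Aχ := Finset.sum_nonneg fun i _ => abs_nonneg _
  have hAa0 : 0 ≤ Aa := Finset.sum_nonneg fun i _ => abs_nonneg _
  refine ⟨2 ^ k * (2 ^ k * (k.factorial * c ^ k) * (2 ^ k * Aψ * Aχ)) * Aa, by positivity, ?_⟩
  rintro j ε r e v ξ χ P a ⟨hj, hε, hXε, he, hχs, -, hχ, hχN, has, ha, hP, hhom, hPb⟩ hv hr hξ
  have hX2 : (2 : ℝ) ≤ 2 ^ j := by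
    calc (2 : ℝ) = 2 ^ 1 := (pow_one _).symm
      _ ≤ 2 ^ j := pow_le_pow_right₀ (by norm_num) hj
  have hX0 : (0 : ℝ) < 2 ^ j := by positivity
  have hε2 : ε ^ 2 ≤ 1 / 2 := by nlinarith [sq_nonneg ε]
  have hε1 : ε ≤ 1 := by nlinarith
  have hrε : ε ^ 2 ≤ r := by
    rcases hr with ⟨_, rfl⟩ | rfl
    · exact le_rfl
    · nlinarith
  have hr0 : 0 ≤ r := (sq_nonneg ε).trans hrε
  have hU : IsOpen {ξ : Rn n | ξ ≠ 0} := isOpen_ne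
  have hξ0 : ξ ∈ {ξ : Rn n | ξ ≠ 0} := ne_zero_of_mem_dyadicCone hX0 hξ
  have hψs : ContDiffOn ℝ ((⊤ : ℕ∞) : WithTop ℕ∞) (lpPiece n ψ0 j) {ξ : Rn n | ξ ≠ 0} :=
    (contDiff_lpPiece hψ0 hj).contDiffOn
  have hXi : ((2 : ℝ) ^ j)⁻¹ = ε ^ 2 := by
    rw [inv_eq_iff_eq_inv]; exact eq_inv_of_mul_eq_one_left hXε
  have dψ : DirBound {ξ' : Rn n | ξ' ≠ 0} (lpPiece n ψ0 j) ξ v r k (Aψ * 1) := by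
    refine DirBound.of_seq B hr0 zero_le_one fun i _ => ?_
    rw [iteratedFDerivWithin_of_isOpen _ hU hξ0, mul_one]
    refine (norm_apply_const_le _ hv).trans ((hB j hj i ξ).trans ?_)
    have hBi : 0 ≤ B i := by
      have := (norm_nonneg _).trans (hB j hj i ξ)
      exact nonneg_of_mul_nonneg_left this (by positivity)
    rw [hXi]
    gcongr
  have dχ := dirBound_cutoff hX0 hε hXε hv hr hχ hχN hξ k
  have da := dirBound_symbol (by linarith) hXε hv hrε ha hξ k
  rw [← hAχ, mul_one] at dχ
  rw [mul_one] at dψ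
  rw [← hAa] at da
  have hhs : ContDiffOn ℝ ((⊤ : ℕ∞) : WithTop ℕ∞) (fun z => P z - fderiv ℝ P e z)
      {ξ | ξ ≠ 0} := hP.sub (fderiv ℝ P e).contDiff.contDiffOn
  have dh := DirBound.cexp hU hξ0 hhs hr0 hc1
    (hc P e v ξ (2 ^ j) ε r hP hhom hPb he hv hX0 hε hXε hε2 hr hξ)
  have hofReal : ∀ {f : Rn n → ℝ}, ContDiffOn ℝ ((⊤ : ℕ∞) : WithTop ℕ∞) f {ξ | ξ ≠ 0} →
      ContDiffOn ℝ ((⊤ : ℕ∞) : WithTop ℕ∞) (fun y => (f y : ℂ)) {ξ | ξ ≠ 0} := fun hf =>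
    Complex.ofRealCLM.contDiff.comp_contDiffOn hf
  have hes : ContDiffOn ℝ ((⊤ : ℕ∞) : WithTop ℕ∞)
      (fun z => Complex.exp (Complex.I * ((P z - fderiv ℝ P e z : ℝ) : ℂ))) {ξ | ξ ≠ 0} :=
    contDiff_exp_I_mul.comp_contDiffOn hhs
  have d1 := DirBound.mul hU hξ0 (hofReal hψs) (hofReal hχs) hr0 hAψ0 hAχ0
    (dψ.ofReal hU hξ0 hψs) (dχ.ofReal hU hξ0 hχs)
  have d2 := DirBound.mul hU hξ0 hes ((hofReal hψs).mul (hofReal hχs)) hr0 (by positivity)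
    (by positivity) dh d1
  have d3 := DirBound.mul hU hξ0 (hes.mul ((hofReal hψs).mul (hofReal hχs))) has.contDiffOn hr0
    (by positivity) (by positivity) d2 da
  have := d3 k le_rfl
  rw [iteratedFDerivWithin_of_isOpen _ hU hξ0] at this
  simp only [← Complex.ofReal_mul] at this
  refine (this.trans (le_of_eq ?_) :)
  ring

theorem dyadicCone_of_pieceAmplitude_ne_zero {ψ0 : Rn n → ℝ} (hψ0 : IsLPBase n ψ0) {m : ℝ}
    {Ca Cφ Cχ CχN : ℕ → ℝ} {j : ℕ} {ε : ℝ} {e ξ : Rn n} {χ P : Rn n → ℝ} {a : Rn n → ℂ}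
    (h : SecondDyadicPiece m Ca Cφ Cχ CχN j ε e χ P a)
    (hξ : pieceAmplitude ψ0 j e χ P a ξ ≠ 0) : ξ ∈ dyadicCone e (2 ^ j) ε := by
  have hX0 : (0 : ℝ) < 2 ^ j := by positivity
  have h1 : ((lpPiece n ψ0 j ξ * χ ξ : ℝ) : ℂ) ≠ 0 := fun h0 => hξ (by
    rw [pieceAmplitude, h0, mul_zero, zero_mul])
  have h2 : lpPiece n ψ0 j ξ ≠ 0 ∧ χ ξ ≠ 0 := mul_ne_zero_iff.1 (by exact_mod_cast h1)
  obtain ⟨h3, h4⟩ := norm_mem_of_lpPiece_ne_zero hψ0 h.one_le h2.1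
  have hρ : 0 < ‖ξ‖ := by linarith
  refine ⟨h3, h4, ?_⟩
  have h5 := h.cutoff_support ξ (norm_pos_iff.1 hρ) h2.2
  calc ‖ξ - ‖ξ‖ • e‖ = ‖‖ξ‖ • (‖ξ‖⁻¹ • ξ - e)‖ := by
        rw [smul_sub, smul_inv_smul₀ hρ.ne']
    _ = ‖ξ‖ * ‖‖ξ‖⁻¹ • ξ - e‖ := by rw [norm_smul, norm_norm]
    _ ≤ ‖ξ‖ * (2 * ε) := by gcongr
    _ = _ := mul_comm _ _

theorem contDiff_pieceAmplitude {ψ0 : Rn n → ℝ} (hψ0 : IsLPBase n ψ0) {m : ℝ}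
    {Ca Cφ Cχ CχN : ℕ → ℝ} {j : ℕ} {ε : ℝ} {e : Rn n} {χ P : Rn n → ℝ} {a : Rn n → ℂ}
    (h : SecondDyadicPiece m Ca Cφ Cχ CχN j ε e χ P a) :
    ContDiff ℝ ((⊤ : ℕ∞) : WithTop ℕ∞) (pieceAmplitude ψ0 j e χ P a) := by
  have hX0 : (0 : ℝ) < 2 ^ j := by positivity
  have hhs : ContDiffOn ℝ ((⊤ : ℕ∞) : WithTop ℕ∞) (fun z => P z - fderiv ℝ P e z)
      {ξ | ξ ≠ 0} := h.phase_contDiffOn.sub (fderiv ℝ P e).contDiff.contDiffOn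
  have hon : ContDiffOn ℝ ((⊤ : ℕ∞) : WithTop ℕ∞) (pieceAmplitude ψ0 j e χ P a) {ξ | ξ ≠ 0} :=
    ((contDiff_exp_I_mul.comp_contDiffOn hhs).mul (Complex.ofRealCLM.contDiff.comp_contDiffOn
      ((contDiff_lpPiece hψ0 h.one_le).contDiffOn.mul h.cutoff_contDiffOn))).mul
        h.symbol_contDiff.contDiffOn
  refine contDiff_iff_contDiffAt.2 fun ξ => ?_
  by_cases hξ : ξ = 0
  · refine (contDiffAt_const (c := (0 : ℂ))).congr_of_eventuallyEq ?_
    filter_upwards [Metric.ball_mem_nhds ξ (half_pos hX0)] with z hz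
    by_contra hne
    have := (dyadicCone_of_pieceAmplitude_ne_zero hψ0 h hne).1
    rw [hξ, mem_ball_zero_iff] at hz
    linarith
  · exact hon.contDiffAt (isOpen_ne.mem_nhds hξ)

theorem exists_pow_mul_norm_integral_pieceAmplitude_le (m : ℝ) {ψ0 : Rn n → ℝ}
    (hψ0 : IsLPBase n ψ0) (Ca Cφ Cχ CχN : ℕ → ℝ) (k : ℕ) :
    ∃ M : ℝ, 0 ≤ M ∧ ∀ (j : ℕ) (ε r : ℝ) (e v g : Rn n) (χ P : Rn n → ℝ) (a : Rn n → ℂ),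
      SecondDyadicPiece m Ca Cφ Cχ CχN j ε e χ P a → ‖v‖ ≤ 1 → (v = e ∧ r = ε ^ 2 ∨ r = ε) →
      (r⁻¹ * |⟪g, v⟫_ℝ|) ^ k *
        ‖∫ ξ, Complex.exp (Complex.I * ((⟪g, ξ⟫_ℝ : ℝ) : ℂ)) * pieceAmplitude ψ0 j e χ P a ξ‖ ≤
          M * (((2 : ℝ) ^ j) ^ m * ε⁻¹ ^ (n + 1)) := by
  obtain ⟨M, hM0, hM⟩ := exists_norm_iteratedFDeriv_pieceAmplitude_le m hψ0 Ca Cφ Cχ CχN k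
  set κ : ℝ := (volume (Metric.closedBall (0 : Rn n) 2)).toReal with hκ
  refine ⟨M * (4 ^ n * κ), by positivity, ?_⟩
  intro j ε r e v g χ P a h hv hr
  have hX0 : (0 : ℝ) < 2 ^ j := by positivity
  have hε := h.pos
  have hr0 : 0 < r := by rcases hr with ⟨_, rfl⟩ | rfl <;> positivity
  have hεX : ε * 2 ^ j = ε⁻¹ := by
    refine eq_inv_of_mul_eq_one_left ?_
    rw [← h.mul_sq]; ring
  have hVeq : (4 * ε * 2 ^ j) ^ n * (2 * 2 ^ j / (4 * ε * 2 ^ j)) ≤ 4 ^ n * ε⁻¹ ^ (n + 1) := by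
    rw [mul_assoc, hεX, mul_pow, pow_succ, ← mul_assoc]
    gcongr
    rw [← hεX, div_le_iff₀ (by positivity)]
    nlinarith [h.mul_sq, sq_nonneg ε]
  have hV : volume (dyadicCone e (2 ^ j) ε) ≤
      ENNReal.ofReal (4 ^ n * ε⁻¹ ^ (n + 1) * κ) := by
    refine (volume_dyadicCone_le h.norm_eq hX0 hε).trans ?_
    rw [finrank_euclideanSpace_fin,
      ENNReal.ofReal_mul (p := 4 ^ n * ε⁻¹ ^ (n + 1)) (by positivity), hκ,
      ENNReal.ofReal_toReal measure_closedBall_lt_top.ne]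
    gcongr
  have key := pow_mul_norm_integral_exp_inner_le (contDiff_pieceAmplitude hψ0 h)
    (isCompact_dyadicCone e (2 ^ j) ε) (fun ξ hξ => dyadicCone_of_pieceAmplitude_ne_zero hψ0 h hξ)
    g v k (fun ξ hξ => hM j ε r e v ξ χ P a h hv hr hξ) (by positivity) hV (by positivity)
  rw [mul_pow, mul_assoc]
  refine (mul_le_mul_of_nonneg_left key (by positivity)).trans (le_of_eq ?_)
  have : r⁻¹ ^ k * r ^ k = 1 := by rw [← mul_pow, inv_mul_cancel₀ hr0.ne', one_pow]
  calc _ = r⁻¹ ^ k * r ^ k * (M * (4 ^ n * κ) * (((2 : ℝ) ^ j) ^ m * ε⁻¹ ^ (n + 1))) := by ring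
    _ = _ := by rw [this, one_mul]

end AmplitudeBounds

section KernelPhase

variable {n : ℕ}

theorem PhaseClass.exists_phase_bound {φ : Rn n → Rn n → ℝ} (hφ : PhaseClass n 2 φ) :
    ∃ Cφ : ℕ → ℝ, ∀ l, 1 ≤ l → ∀ x ξ : Rn n, ξ ≠ 0 →
      ‖ξ‖ ^ l * ‖iteratedFDeriv ℝ (l + 1) (φ x) ξ‖ ≤ Cφ (l + 1) := by
  have h : ∀ k : ℕ, ∃ C : ℝ, 2 ≤ k → ∀ x ξ : Rn n, ξ ≠ 0 →
      ‖ξ‖ ^ ((k : ℝ) - 1) * ‖iteratedFDeriv ℝ k (φ x) ξ‖ ≤ C := by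
    intro k
    by_cases hk : 2 ≤ k
    · obtain ⟨C, hC⟩ := hφ.2 k 0 (by omega)
      refine ⟨C, fun _ x ξ hξ => ?_⟩
      have := hC x ξ hξ
      have hcomp : (fun ξ' => iteratedFDeriv ℝ 0 (fun x' => φ x' ξ') x) =
          (continuousMultilinearCurryFin0 ℝ (Rn n) ℝ).symm ∘ φ x := by
        ext ξ' m
        simp
      rw [hcomp, LinearIsometryEquiv.norm_iteratedFDerivWithin_comp_left _ _
        (isOpen_ne.uniqueDiffOn) hξ, iteratedFDerivWithin_of_isOpen _ isOpen_ne hξ] at this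
      exact this
    · exact ⟨0, fun h => absurd h hk⟩
  choose C hC using h
  refine ⟨C, fun l hl x ξ hξ => ?_⟩
  have := hC (l + 1) (by omega) x ξ hξ
  rwa [Nat.cast_add, Nat.cast_one, add_sub_cancel_right, Real.rpow_natCast] at this

theorem PhaseClass.contDiffOn {k : ℕ} {φ : Rn n → Rn n → ℝ} (hφ : PhaseClass n k φ) (x : Rn n) :
    ContDiffOn ℝ ((⊤ : ℕ∞) : WithTop ℕ∞) (φ x) {ξ | ξ ≠ 0} :=
  hφ.1.1.comp (f := fun ξ : Rn n => (x, ξ)) (by fun_prop) fun _ hξ => hξ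

/-- The kernel phase is smooth and homogeneous, and its derivatives of order at least two are
bounded like those of the original phase. -/
theorem PhaseClass.exists_kernelPhase_bound {φ : Rn n → Rn n → ℝ} (hφ : PhaseClass n 2 φ)
    {Φ : Rn n → Rn n → Rn n → ℝ}
    (hΦ : (Φ = fun x y ξ => φ x ξ - ⟪y, ξ⟫_ℝ) ∨ (Φ = fun x y ξ => ⟪x, ξ⟫_ℝ - φ y ξ)) :
    ∃ Cφ : ℕ → ℝ, ∀ x y : Rn n, ContDiffOn ℝ ((⊤ : ℕ∞) : WithTop ℕ∞) (Φ x y) {ξ | ξ ≠ 0} ∧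
      (∀ (ξ : Rn n) (t : ℝ), 0 < t → Φ x y (t • ξ) = t * Φ x y ξ) ∧
      ∀ l, 1 ≤ l → ∀ ξ : Rn n, ξ ≠ 0 →
        ‖ξ‖ ^ l * ‖iteratedFDeriv ℝ (l + 1) (Φ x y) ξ‖ ≤ Cφ (l + 1) := by
  obtain ⟨Cφ, hC⟩ := hφ.exists_phase_bound
  have hat : ∀ x ξ : Rn n, ξ ≠ 0 → ContDiffAt ℝ ((⊤ : ℕ∞) : WithTop ℕ∞) (φ x) ξ :=
    fun x ξ hξ => (hφ.contDiffOn x).contDiffAt (isOpen_ne.mem_nhds hξ)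
  have hsub : ∀ x y ξ : Rn n, ξ ≠ 0 → ∀ l, 1 ≤ l →
      iteratedFDeriv ℝ (l + 1) (fun ξ => φ x ξ - ⟪y, ξ⟫_ℝ) ξ =
        iteratedFDeriv ℝ (l + 1) (φ x) ξ := by
    intro x y ξ hξ l hl
    obtain ⟨l, rfl⟩ : ∃ l', l = l' + 1 := ⟨l - 1, by omega⟩
    exact iteratedFDeriv_sub_clm (hat x ξ hξ) (innerSL ℝ y) l
  have hcd : ∀ x y : Rn n, ContDiffOn ℝ ((⊤ : ℕ∞) : WithTop ℕ∞)
      (fun ξ => φ x ξ - ⟪y, ξ⟫_ℝ) {ξ | ξ ≠ 0} := fun x y =>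
    (hφ.contDiffOn x).sub (innerSL ℝ y).contDiff.contDiffOn
  refine ⟨Cφ, fun x y => ?_⟩
  rcases hΦ with rfl | rfl
  · refine ⟨hcd x y, fun ξ t ht => ?_, fun l hl ξ hξ => ?_⟩
    · simp only [hφ.1.2 x ξ t ht, inner_smul_right]
      ring
    · rw [hsub x y ξ hξ l hl]
      exact hC l hl x ξ hξ
  · have hneg : (fun ξ => ⟪x, ξ⟫_ℝ - φ y ξ) = -fun ξ => φ y ξ - ⟪x, ξ⟫_ℝ := by
      ext ξ; simp
    refine ⟨?_, fun ξ t ht => ?_, fun l hl ξ hξ => ?_⟩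
    · change ContDiffOn ℝ _ (fun ξ => ⟪x, ξ⟫_ℝ - φ y ξ) _
      rw [hneg]
      exact (hcd y x).neg
    · simp only [hφ.1.2 y ξ t ht, inner_smul_right]
      ring
    · change _ * ‖iteratedFDeriv ℝ (l + 1) (fun ξ => ⟪x, ξ⟫_ℝ - φ y ξ) ξ‖ ≤ _
      rw [hneg, iteratedFDeriv_neg_apply, norm_neg, hsub y x ξ hξ l hl]
      exact hC l hl y ξ hξ

theorem le_mul_rpow_neg_of_pow_mul_le {I W A B : ℝ} (N : ℕ) (hI : 0 ≤ I) (h0 : I ≤ W)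
    (hA : |A| ^ (4 * N) * I ≤ W) (hB : |B| ^ (4 * N) * I ≤ W) :
    I ≤ 2 * 4 ^ N * W * (1 + A ^ 2) ^ (-(N : ℝ)) * (1 + B ^ 2) ^ (-(N : ℝ)) := by
  have key : ∀ D : ℝ, |D| ^ (4 * N) * I ≤ W → ((1 + D ^ 2) ^ N) ^ 2 * I ≤ 2 * 4 ^ N * W := by
    intro D hD
    have h1 : (1 + D ^ 2) ^ (2 * N) ≤ 4 ^ N * (1 + |D| ^ (4 * N)) := by
      refine (add_pow_le zero_le_one (sq_nonneg D) (2 * N)).trans ?_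
      rw [one_pow, ← sq_abs D, ← pow_mul, show 2 * (2 * N) = 4 * N by ring]
      gcongr
      calc (2 : ℝ) ^ (2 * N - 1) ≤ 2 ^ (2 * N) := pow_le_pow_right₀ (by norm_num) (by omega)
        _ = 4 ^ N := by rw [pow_mul]; norm_num
    rw [← pow_mul, mul_comm N 2]
    calc (1 + D ^ 2) ^ (2 * N) * I ≤ 4 ^ N * (1 + |D| ^ (4 * N)) * I := by gcongr
      _ = 4 ^ N * (I + |D| ^ (4 * N) * I) := by ring
      _ ≤ 4 ^ N * (W + W) := by gcongr
      _ = _ := by ring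
  have hp : 0 < (1 + A ^ 2) ^ N := by positivity
  have hq : 0 < (1 + B ^ 2) ^ N := by positivity
  rw [Real.rpow_neg (by positivity), Real.rpow_neg (by positivity), Real.rpow_natCast,
    Real.rpow_natCast, ← div_eq_mul_inv, ← div_eq_mul_inv, le_div_iff₀ hq, le_div_iff₀ hp]
  have h1 := key A hA
  have h2 := key B hB
  nlinarith [mul_nonneg hI (sq_nonneg ((1 + A ^ 2) ^ N - (1 + B ^ 2) ^ N))]

theorem integral_exp_phase_eq {P : Rn n → ℝ} (ψ0 : Rn n → ℝ) (j : ℕ) (e : Rn n) (χ : Rn n → ℝ)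
    (a : Rn n → ℂ) :
    (∫ ξ : Rn n, Complex.exp (Complex.I * ((P ξ : ℝ) : ℂ)) *
      ((lpPiece n ψ0 j ξ * χ ξ : ℝ) : ℂ) * a ξ) =
    ∫ ξ, Complex.exp (Complex.I * ((⟪gradient P e, ξ⟫_ℝ : ℝ) : ℂ)) *
      pieceAmplitude ψ0 j e χ P a ξ := by
  congr 1
  ext ξ
  rw [pieceAmplitude, gradient, InnerProductSpace.toDual_symm_apply, ← mul_assoc, ← mul_assoc,
    ← Complex.exp_add, ← mul_add, ← Complex.ofReal_add, add_sub_cancel]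

end KernelPhase

end KernelEstimate

/-- Seeger–Sogge–Stein kernel estimate for a second-dyadic piece of an FIO:
with `Φ(x,y,ξ) = φ(x,ξ) - y·ξ` or `x·ξ - φ(y,ξ)`, a unit vector `e = ξ_j^ν`, and a cut-off
`χ = χ_j^ν` supported in the cone of aperture `2·2^{-j/2}` around `e` with the standard
derivative bounds, the kernel `K_j^ν(x,y) = (2π)^{-n} ∫ e^{iΦ} ψ_j χ a dξ` satisfies
`|K_j^ν(x,y)| ≤ C 2^{j(m+(n+1)/2)} (1+|2^j ∂_{ξ₁}Φ|²)^{-N} (1+|2^{j/2} ∇_{ξ'}Φ|²)^{-N}`,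
the derivatives of `Φ` being taken in `ξ` at `ξ_j^ν`, in the direction of `e` and
orthogonally to `e` respectively, with `C` independent of `j`, `ν`, `x`, `y`. -/
theorem sss_kernel_estimate
    (n : ℕ) (hn : 1 ≤ n) (m : ℝ)
    (ψ0 : Rn n → ℝ) (hψ0 : IsLPBase n ψ0)
    (Ca : ℕ → ℝ) (a : Rn n → Rn n → Rn n → ℂ)
    (ha_meas : ∀ ξ : Rn n, Measurable fun p : Rn n × Rn n => a p.1 p.2 ξ)
    (ha_smooth : ∀ x y : Rn n, ContDiff ℝ (⊤ : ℕ∞) fun ξ => a x y ξ)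
    (ha_bound : ∀ k : ℕ, ∀ x y ξ : Rn n,
      ‖iteratedFDeriv ℝ k (fun ξ' => a x y ξ') ξ‖ ≤ Ca k * (1 + ‖ξ‖ ^ 2) ^ ((m - (k : ℝ)) / 2))
    (φ : Rn n → Rn n → ℝ) (hφ : PhaseClass n 2 φ)
    (Φ : Rn n → Rn n → Rn n → ℝ)
    (hΦ : (Φ = fun x y ξ => φ x ξ - ⟪y, ξ⟫_ℝ) ∨ (Φ = fun x y ξ => ⟪x, ξ⟫_ℝ - φ y ξ))
    (Cχ CχN : ℕ → ℝ) (N : ℕ) :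
    ∃ C : ℝ, ∀ j : ℕ, 1 ≤ j → ∀ e : Rn n, ‖e‖ = 1 → ∀ χ : Rn n → ℝ,
      ContDiffOn ℝ (⊤ : ℕ∞) χ {ξ : Rn n | ξ ≠ 0} →
      (∀ ξ : Rn n, ξ ≠ 0 → χ ξ ≠ 0 → ‖‖ξ‖⁻¹ • ξ - e‖ ≤ 2 * (2 : ℝ) ^ (-(j : ℝ) / 2)) →
      (∀ k : ℕ, ∀ ξ : Rn n, ξ ≠ 0 →
        ‖iteratedFDerivWithin ℝ k χ {ξ' : Rn n | ξ' ≠ 0} ξ‖ ≤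
          Cχ k * (2 : ℝ) ^ ((j : ℝ) * (k : ℝ) / 2) * ‖ξ‖ ^ (-(k : ℝ))) →
      (∀ N' : ℕ, 1 ≤ N' → ∀ ξ : Rn n, ξ ≠ 0 →
        |iteratedFDerivWithin ℝ N' χ {ξ' : Rn n | ξ' ≠ 0} ξ (fun _ => e)| ≤
          CχN N' * ‖ξ‖ ^ (-(N' : ℝ))) →
      ∀ x y : Rn n,
        ‖((((2 * Real.pi) ^ n)⁻¹ : ℝ) : ℂ) *
            ∫ ξ : Rn n, Complex.exp (Complex.I * ((Φ x y ξ : ℝ) : ℂ)) *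
              (((lpPiece n ψ0 j ξ * χ ξ : ℝ)) : ℂ) * a x y ξ‖ ≤
          C * (2 : ℝ) ^ ((j : ℝ) * (m + ((n : ℝ) + 1) / 2)) *
            (1 + ((2 : ℝ) ^ (j : ℝ) * ⟪gradient (fun ξ => Φ x y ξ) e, e⟫_ℝ) ^ 2) ^ (-(N : ℝ)) *
            (1 + ‖(2 : ℝ) ^ ((j : ℝ) / 2) •
              (gradient (fun ξ => Φ x y ξ) e -
                ⟪gradient (fun ξ => Φ x y ξ) e, e⟫_ℝ • e)‖ ^ 2) ^ (-(N : ℝ)) := by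
  obtain ⟨Cφ, hP⟩ := hφ.exists_kernelPhase_bound hΦ
  obtain ⟨M0, hM0, h0⟩ :=
    exists_pow_mul_norm_integral_pieceAmplitude_le m hψ0 Ca Cφ Cχ CχN 0
  obtain ⟨M1, hM1, h1⟩ :=
    exists_pow_mul_norm_integral_pieceAmplitude_le m hψ0 Ca Cφ Cχ CχN (4 * N)
  refine ⟨((2 * Real.pi) ^ n)⁻¹ * (2 * 4 ^ N * (M0 + M1)), ?_⟩
  intro j hj e he χ hχs hχsupp hχ hχN x y
  obtain ⟨hPs, hPh, hPb⟩ := hP x y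
  set ε : ℝ := (2 : ℝ) ^ (-(j : ℝ) / 2) with hε
  have hε0 : 0 < ε := by positivity
  have hεi : ε⁻¹ = (2 : ℝ) ^ ((j : ℝ) / 2) := by
    rw [hε, ← Real.rpow_neg two_pos.le]
    congr 1
    ring
  have hε2 : (ε ^ 2)⁻¹ = (2 : ℝ) ^ (j : ℝ) := by
    rw [← inv_pow, hεi, ← Real.rpow_natCast, ← Real.rpow_mul two_pos.le]
    congr 1
    push_cast
    ring
  have hpiece : SecondDyadicPiece m Ca Cφ Cχ CχN j ε e χ (Φ x y) (a x y) :=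
    { one_le := hj
      pos := hε0
      mul_sq := by
        rw [← Real.rpow_natCast 2 j, ← hε2, inv_mul_cancel₀ (by positivity)]
      norm_eq := he
      cutoff_contDiffOn := hχs
      cutoff_support := hχsupp
      cutoff_bound := fun k ξ hξ => by
        refine (hχ k ξ hξ).trans (le_of_eq ?_)
        rw [hεi, Real.rpow_neg (norm_nonneg _), Real.rpow_natCast, inv_pow,
          ← Real.rpow_natCast ((2 : ℝ) ^ ((j : ℝ) / 2)) k, ← Real.rpow_mul two_pos.le]
        congr 3
        ring
      cutoff_bound_axis := fun k hk ξ hξ => by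
        refine (hχN k hk ξ hξ).trans (le_of_eq ?_)
        rw [Real.rpow_neg (norm_nonneg _), Real.rpow_natCast, inv_pow]
      symbol_contDiff := ha_smooth x y
      symbol_bound := fun k ξ => ha_bound k x y ξ
      phase_contDiffOn := hPs
      phase_homog := hPh
      phase_bound := hPb }
  change ‖_ * ∫ ξ : Rn n, Complex.exp (Complex.I * ((Φ x y ξ : ℝ) : ℂ)) *
    ((lpPiece n ψ0 j ξ * χ ξ : ℝ) : ℂ) * a x y ξ‖ ≤ _
  rw [integral_exp_phase_eq ψ0 j e χ (a x y), norm_mul, Complex.norm_real,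
    Real.norm_of_nonneg (by positivity)]
  change _ ≤ _ * (1 + (_ * ⟪gradient (Φ x y) e, e⟫_ℝ) ^ 2) ^ _ * (1 + ‖_ • (gradient (Φ x y) e -
    ⟪gradient (Φ x y) e, e⟫_ℝ • e)‖ ^ 2) ^ _
  set g := gradient (Φ x y) e with hg
  set b := g - ⟪g, e⟫_ℝ • e with hb
  set J := ‖∫ ξ, Complex.exp (Complex.I * ((⟪g, ξ⟫_ℝ : ℝ) : ℂ)) *
    pieceAmplitude ψ0 j e χ (Φ x y) (a x y) ξ‖ with hJ
  set Y : ℝ := ((2 : ℝ) ^ j) ^ m * ε⁻¹ ^ (n + 1) with hY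
  have hY0 : 0 ≤ Y := by positivity
  have hYeq : Y = (2 : ℝ) ^ ((j : ℝ) * (m + ((n : ℝ) + 1) / 2)) := by
    rw [hY, hεi, ← Real.rpow_natCast 2 j, ← Real.rpow_natCast _ (n + 1), ← Real.rpow_mul two_pos.le,
      ← Real.rpow_mul two_pos.le, ← Real.rpow_add two_pos]
    congr 1
    push_cast
    ring
  have hbg : ⟪g, ‖b‖⁻¹ • b⟫_ℝ = ‖b‖ := by
    have hbe : ⟪e, b⟫_ℝ = 0 := by
      rw [hb, inner_sub_right, inner_smul_right, real_inner_self_eq_norm_sq, he, real_inner_comm]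
      ring
    have hgb : g = b + ⟪g, e⟫_ℝ • e := by rw [hb, sub_add_cancel]
    have : ⟪g, b⟫_ℝ = ‖b‖ ^ 2 := by
      rw [hgb, inner_add_left, inner_smul_left, hbe, mul_zero, add_zero,
        real_inner_self_eq_norm_sq]
    rw [inner_smul_right, this, sq, ← mul_assoc, inv_mul_mul_self]
  have hbn : ‖‖b‖⁻¹ • b‖ ≤ 1 := by
    rw [norm_smul, norm_inv, norm_norm]
    exact inv_mul_le_one
  have k0 : J ≤ (M0 + M1) * Y := by
    have := h0 j ε ε e e g χ (Φ x y) (a x y) hpiece he.le (Or.inr rfl)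
    rw [pow_zero, one_mul] at this
    exact this.trans (by gcongr; linarith)
  have kA : |(2 : ℝ) ^ (j : ℝ) * ⟪g, e⟫_ℝ| ^ (4 * N) * J ≤ (M0 + M1) * Y := by
    have := h1 j ε (ε ^ 2) e e g χ (Φ x y) (a x y) hpiece he.le (Or.inl ⟨rfl, rfl⟩)
    rw [hε2] at this
    rw [abs_mul, abs_of_pos (by positivity : (0 : ℝ) < 2 ^ (j : ℝ))]
    exact this.trans (by gcongr; linarith)
  have kB : |‖(2 : ℝ) ^ ((j : ℝ) / 2) • b‖| ^ (4 * N) * J ≤ (M0 + M1) * Y := by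
    have := h1 j ε ε e (‖b‖⁻¹ • b) g χ (Φ x y) (a x y) hpiece hbn (Or.inr rfl)
    rw [hbg, abs_norm] at this
    rw [abs_norm, norm_smul, Real.norm_of_nonneg (by positivity), ← hεi]
    exact this.trans (by gcongr; linarith)
  have hfin := le_mul_rpow_neg_of_pow_mul_le N (norm_nonneg _) k0 kA kB
  rw [← hYeq]
  refine (mul_le_mul_of_nonneg_left hfin (by positivity)).trans (le_of_eq ?_)
  ring
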